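/- arXiv:1009.4322 — 9 statements merged into one kernel-verified Lean document; each statement's English description precedes it below -/
import Mathlib

section
/- Let A, B, C be three affinely independent points in the Euclidean plane such that all three side lengths dist(A,B), dist(B,C), dist(C,A) are at least 2. If the largest interior angle of the triangle ABC is at least 2π/3, then the circumradius of the triangle ABC is at least 2. -/
open Real EuclideanGeometry

theorem Affine.Triangle.dist_le_circumradius_of_angle_le_pi_div_six {V P : Type*}
    [NormedAddCommGroup V] [InnerProductSpace ℝ V] [MetricSpace P] [NormedAddTorsor V P]
    (t : Affine.Triangle ℝ P) {i₁ i₂ i₃ : Fin 3} (h₁₂ : i₁ ≠ i₂) (h₁₃ : i₁ ≠ i₃) (h₂₃ : i₂ ≠ i₃)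
    (hangle : ∠ (t.points i₁) (t.points i₂) (t.points i₃) ≤ π / 6) :
    dist (t.points i₁) (t.points i₃) ≤ t.circumradius := by
  have hsin : sin (∠ (t.points i₁) (t.points i₂) (t.points i₃)) ≤ 1 / 2 := by
    rw [← sin_pi_div_six]
    have hnonneg := EuclideanGeometry.angle_nonneg (t.points i₁) (t.points i₂) (t.points i₃)
    exact sin_le_sin_of_le_of_le_pi_div_two (by linarith [pi_pos]) (by linarith [pi_pos]) hangle
  have hcol : ¬ Collinear ℝ {t.points i₁, t.points i₂, t.points i₃} :=
    (affineIndependent_iff_not_collinear_of_ne h₁₂ h₁₃ h₂₃).1 t.independent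
  have hlaw := t.dist_div_sin_angle_eq_two_mul_circumradius h₁₂ h₁₃ h₂₃
  rw [div_eq_iff (sin_pos_of_not_collinear hcol).ne'] at hlaw
  nlinarith [t.circumradius_pos]

theorem circumradius_ge_two_of_large_angle
    (A B C : EuclideanSpace ℝ (Fin 2))
    (h : AffineIndependent ℝ ![A, B, C])
    (hAB : 2 ≤ dist A B) (hBC : 2 ≤ dist B C) (hCA : 2 ≤ dist C A)
    (hangle : 2 * π / 3 ≤ max (∠ B A C) (max (∠ A B C) (∠ B C A))) :
    2 ≤ (⟨![A, B, C], h⟩ : Affine.Triangle ℝ (EuclideanSpace ℝ (Fin 2))).circumradius := by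
  set t : Affine.Triangle ℝ (EuclideanSpace ℝ (Fin 2)) := ⟨![A, B, C], h⟩
  have hBne : B ≠ A := (dist_pos.1 (by linarith)).symm
  have hsum := angle_add_angle_add_angle_eq_pi C hBne
  rw [angle_comm C A B] at hsum
  have hsmall : ∠ B A C ≤ π / 6 ∨ ∠ A B C ≤ π / 6 ∨ ∠ B C A ≤ π / 6 := by
    by_contra! hlarge
    obtain ⟨hA, hB, hC⟩ := hlarge
    rcases le_max_iff.1 hangle with hA' | h'
    · linarith
    rcases le_max_iff.1 h' with hB' | hC' <;> linarith
  rcases hsmall with hA | hB | hC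
  · exact hBC.trans (t.dist_le_circumradius_of_angle_le_pi_div_six
      (i₁ := 1) (i₂ := 0) (i₃ := 2) (by decide) (by decide) (by decide) hA)
  · exact (dist_comm C A ▸ hCA).trans (t.dist_le_circumradius_of_angle_le_pi_div_six
      (i₁ := 0) (i₂ := 1) (i₃ := 2) (by decide) (by decide) (by decide) hB)
  · exact (dist_comm A B ▸ hAB).trans (t.dist_le_circumradius_of_angle_le_pi_div_six
      (i₁ := 1) (i₂ := 2) (i₃ := 0) (by decide) (by decide) (by decide) hC)
end

section
/- Let A, B, C be three affinely independent points in the Euclidean plane such that all three side lengths are at least 2, and suppose the circumradius R of the triangle ABC satisfies R < 2. Then every interior angle of the triangle is strictly greater than π/6, and consequently the largest interior angle is strictly less than 2π/3. -/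
open Real EuclideanGeometry

/-- In a triangle with circumradius less than `r`, an angle opposite a side of length at least `r`
exceeds `π / 6`. -/
theorem pi_div_six_lt_angle_of_circumradius_lt {V P : Type*} [NormedAddCommGroup V]
    [InnerProductSpace ℝ V] [MetricSpace P] [NormedAddTorsor V P] (t : Affine.Triangle ℝ P)
    {r : ℝ} {i₁ i₂ i₃ : Fin 3} (h₁₂ : i₁ ≠ i₂) (h₁₃ : i₁ ≠ i₃) (h₂₃ : i₂ ≠ i₃)
    (hd : r ≤ dist (t.points i₁) (t.points i₃)) (hR : t.circumradius < r) :
    π / 6 < ∠ (t.points i₁) (t.points i₂) (t.points i₃) := by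
  by_contra! hle
  have hlaw := t.dist_div_sin_angle_eq_two_mul_circumradius h₁₂ h₁₃ h₂₃
  have hpos := t.circumradius_pos
  have hsin : sin (∠ (t.points i₁) (t.points i₂) (t.points i₃)) ≤ 1 / 2 := by
    rw [← sin_pi_div_six]
    exact sin_le_sin_of_le_of_le_pi_div_two
      (by linarith [pi_pos, angle_nonneg (t.points i₁) (t.points i₂) (t.points i₃)])
      (by linarith [pi_pos]) hle
  have hne : sin (∠ (t.points i₁) (t.points i₂) (t.points i₃)) ≠ 0 := by
    intro h0
    rw [h0, div_zero] at hlaw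
    linarith
  rw [div_eq_iff hne] at hlaw
  nlinarith

theorem angles_of_small_circumradius
    (A B C : EuclideanSpace ℝ (Fin 2))
    (h : AffineIndependent ℝ ![A, B, C])
    (hAB : 2 ≤ dist A B) (hBC : 2 ≤ dist B C) (hCA : 2 ≤ dist C A)
    (hR : (⟨![A, B, C], h⟩ : Affine.Triangle ℝ (EuclideanSpace ℝ (Fin 2))).circumradius < 2) :
    (π / 6 < ∠ B A C ∧ π / 6 < ∠ A B C ∧ π / 6 < ∠ B C A) ∧
    max (∠ B A C) (max (∠ A B C) (∠ B C A)) < 2 * π / 3 := by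
  let t : Affine.Triangle ℝ (EuclideanSpace ℝ (Fin 2)) := ⟨![A, B, C], h⟩
  have hA : π / 6 < ∠ B A C :=
    pi_div_six_lt_angle_of_circumradius_lt t (i₁ := 1) (i₂ := 0) (i₃ := 2)
      (by decide) (by decide) (by decide) hBC hR
  have hB : π / 6 < ∠ A B C :=
    pi_div_six_lt_angle_of_circumradius_lt t (i₁ := 0) (i₂ := 1) (i₃ := 2)
      (by decide) (by decide) (by decide) (dist_comm C A ▸ hCA) hR
  have hC : π / 6 < ∠ B C A :=
    pi_div_six_lt_angle_of_circumradius_lt t (i₁ := 1) (i₂ := 2) (i₃ := 0)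
      (by decide) (by decide) (by decide) (dist_comm A B ▸ hAB) hR
  have hne : B ≠ A := by
    rintro rfl
    norm_num at hAB
  have hsum := angle_add_angle_add_angle_eq_pi C hne
  rw [angle_comm C A B] at hsum
  refine ⟨⟨hA, hB, hC⟩, max_lt ?_ (max_lt ?_ ?_)⟩ <;> linarith
end

section
/- Let S be a saturated circle configuration in the Euclidean plane, and let A, B, C ∈ S be affinely independent points such that the triangle ABC satisfies the Delaunay (empty circumdisk) condition: every point p ∈ S is at distance at least the circumradius R from the circumcenter O of ABC. Then the largest interior angle θ of the triangle ABC satisfies π/3 ≤ θ < 2π/3. -/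
open Real EuclideanGeometry

/-- In a triangle with circumradius less than `2`, an angle opposite a side of length at least `2`
exceeds `π / 6`. -/
theorem Affine.Triangle.pi_div_six_lt_angle_of_circumradius_lt_two
    {V P : Type*} [NormedAddCommGroup V] [InnerProductSpace ℝ V] [MetricSpace P]
    [NormedAddTorsor V P] (t : Affine.Triangle ℝ P) (hR : t.circumradius < 2)
    {i j k : Fin 3} (hij : i ≠ j) (hik : i ≠ k) (hjk : j ≠ k)
    (hd : 2 ≤ dist (t.points i) (t.points k)) :
    π / 6 < ∠ (t.points i) (t.points j) (t.points k) := by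
  have hs := t.dist_div_sin_angle_eq_two_mul_circumradius hij hik hjk
  set θ := ∠ (t.points i) (t.points j) (t.points k)
  by_contra! hθ
  have h0 : 0 ≤ θ := EuclideanGeometry.angle_nonneg _ _ _
  have hsin : Real.sin θ ≤ 1 / 2 := by
    rw [← Real.sin_pi_div_six]
    exact Real.sin_le_sin_of_le_of_le_pi_div_two (by linarith [Real.pi_pos])
      (by linarith [Real.pi_pos]) hθ
  have hpos : 0 < Real.sin θ := by
    refine (Real.sin_nonneg_of_nonneg_of_le_pi h0 (EuclideanGeometry.angle_le_pi _ _ _)).lt_of_ne ?_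
    intro h
    have hr := t.circumradius_pos
    rw [← h, div_zero] at hs
    linarith
  rw [div_eq_iff hpos.ne'] at hs
  nlinarith

theorem delaunay_largest_angle_bounds
    (S : Set (EuclideanSpace ℝ (Fin 2)))
    (hpack : ∀ p ∈ S, ∀ q ∈ S, p ≠ q → 2 ≤ dist p q)
    (hsat : ∀ x : EuclideanSpace ℝ (Fin 2), ∃ p ∈ S, dist x p < 2)
    (A B C : EuclideanSpace ℝ (Fin 2)) (hA : A ∈ S) (hB : B ∈ S) (hC : C ∈ S)
    (h : AffineIndependent ℝ ![A, B, C])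
    (hdel : ∀ p ∈ S,
      (⟨![A, B, C], h⟩ : Affine.Triangle ℝ (EuclideanSpace ℝ (Fin 2))).circumradius ≤
        dist p (⟨![A, B, C], h⟩ : Affine.Triangle ℝ (EuclideanSpace ℝ (Fin 2))).circumcenter) :
    π / 3 ≤ max (∠ B A C) (max (∠ A B C) (∠ B C A)) ∧
    max (∠ B A C) (max (∠ A B C) (∠ B C A)) < 2 * π / 3 := by
  set t : Affine.Triangle ℝ (EuclideanSpace ℝ (Fin 2)) := ⟨![A, B, C], h⟩
  have hR : t.circumradius < 2 := by
    obtain ⟨p, hp, hlt⟩ := hsat t.circumcenter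
    rw [dist_comm] at hlt
    exact (hdel p hp).trans_lt hlt
  have hAB : A ≠ B := h.injective.ne (show (0 : Fin 3) ≠ 1 by decide)
  have hAC : A ≠ C := h.injective.ne (show (0 : Fin 3) ≠ 2 by decide)
  have hBC : B ≠ C := h.injective.ne (show (1 : Fin 3) ≠ 2 by decide)
  have hα : π / 6 < ∠ B A C :=
    t.pi_div_six_lt_angle_of_circumradius_lt_two hR (i := 1) (j := 0) (k := 2)
      (by decide) (by decide) (by decide) (hpack B hB C hC hBC)
  have hβ : π / 6 < ∠ A B C :=
    t.pi_div_six_lt_angle_of_circumradius_lt_two hR (i := 0) (j := 1) (k := 2)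
      (by decide) (by decide) (by decide) (hpack A hA C hC hAC)
  have hγ : π / 6 < ∠ B C A :=
    t.pi_div_six_lt_angle_of_circumradius_lt_two hR (i := 1) (j := 2) (k := 0)
      (by decide) (by decide) (by decide) (hpack B hB A hA hAB.symm)
  have hsum : ∠ A B C + ∠ B C A + ∠ C A B = π := angle_add_angle_add_angle_eq_pi C hAB.symm
  rw [angle_comm C A B] at hsum
  constructor
  · by_contra! hlt
    simp only [max_lt_iff] at hlt
    linarith [hlt.1, hlt.2.1, hlt.2.2]
  · simp only [max_lt_iff]
    refine ⟨?_, ?_, ?_⟩ <;> linarith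
end

section
/- Let A, B, C be three affinely independent points in the Euclidean plane with all three side lengths at least 2 and largest interior angle strictly less than 2π/3. If the area of the triangle ABC equals √3, then the triangle is equilateral with all side lengths equal to 2. -/
open Real EuclideanGeometry MeasureTheory

/-- A triangle in the plane has area at least half that of the parallelogram spanned by two of its
sides, because the triangle and a point reflection of it cover the parallelogram. -/
theorem ofReal_abs_cross_le_two_mul_volume_convexHull (A B C : EuclideanSpace ℝ (Fin 2)) :
    ENNReal.ofReal |(B - A) 0 * (C - A) 1 - (B - A) 1 * (C - A) 0| ≤
      2 * volume (convexHull ℝ ({A, B, C} : Set (EuclideanSpace ℝ (Fin 2)))) := by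
  set T := convexHull ℝ ({A, B, C} : Set (EuclideanSpace ℝ (Fin 2))) with hT
  have hA : A ∈ T := subset_convexHull ℝ _ (by simp)
  have hB : B ∈ T := subset_convexHull ℝ _ (by simp)
  have hC : C ∈ T := subset_convexHull ℝ _ (by simp)
  have mem_T : ∀ s t : ℝ, 0 ≤ s → 0 ≤ t → s + t ≤ 1 → A + (s • (B - A) + t • (C - A)) ∈ T := by
    intro s t hs ht hst
    have := (convex_convexHull ℝ ({A, B, C} : Set (EuclideanSpace ℝ (Fin 2)))).sum_mem
      (t := Finset.univ) (w := ![1 - s - t, s, t]) (z := ![A, B, C])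
      (by intro i _; fin_cases i <;> simp <;> linarith)
      (by simp only [Fin.sum_univ_three, Matrix.cons_val]; ring)
      (by intro i _; fin_cases i <;> simp [← hT, hA, hB, hC])
    simp only [Fin.sum_univ_three, Matrix.cons_val] at this
    convert this using 1
    module
  have hcover : parallelepiped ![B - A, C - A] ⊆
      (fun x => A + x) ⁻¹' T ∪ (fun x => (B + C - A) - x) ⁻¹' T := by
    intro x hx
    obtain ⟨t, ⟨h0, h1⟩, rfl⟩ := hx
    have h00 := h0 0
    have h01 := h0 1
    have h10 := h1 0
    have h11 := h1 1
    simp only [Pi.zero_apply, Pi.one_apply] at h00 h01 h10 h11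
    simp only [Fin.sum_univ_two, Matrix.cons_val]
    rcases le_total (t 0 + t 1) 1 with h | h
    · exact Or.inl (mem_T _ _ h00 h01 h)
    · refine Or.inr ?_
      have := mem_T (1 - t 0) (1 - t 1) (by linarith) (by linarith) (by linarith)
      rw [Set.mem_preimage]
      convert this using 1
      module
  have hvol : volume (parallelepiped ![B - A, C - A]) =
      ENNReal.ofReal |(B - A) 0 * (C - A) 1 - (B - A) 1 * (C - A) 0| := by
    have := Measure.addHaar_parallelepiped (EuclideanSpace.basisFun (Fin 2) ℝ).toBasis
      ![B - A, C - A]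
    rw [OrthonormalBasis.addHaar_eq_volume] at this
    rw [this, Module.Basis.det_apply, Matrix.det_fin_two]
    simp [Module.Basis.toMatrix_apply, mul_comm]
  calc _ = volume (parallelepiped ![B - A, C - A]) := hvol.symm
    _ ≤ volume ((fun x => A + x) ⁻¹' T ∪ (fun x => (B + C - A) - x) ⁻¹' T) :=
      measure_mono hcover
    _ ≤ volume ((fun x => A + x) ⁻¹' T) + volume ((fun x => (B + C - A) - x) ⁻¹' T) :=
      measure_union_le _ _
    _ = 2 * volume T := by
      have hreflect : volume ((fun x => (B + C - A) - x) ⁻¹' T) = volume T :=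
        (Measure.measurePreserving_sub_left volume (B + C - A)).measure_preimage
          ((convex_convexHull ℝ _).nullMeasurableSet volume)
      rw [measure_preimage_add, hreflect, two_mul]

/-- If the longest side of a triangle is opposite `A`, the angle at `A` is less than `2π/3`, the
sides at `A` have length at least `2` and the area is at most `√3`, then all sides have
length `2`. -/
theorem dist_eq_two_of_volume_convexHull_le (A B C : EuclideanSpace ℝ (Fin 2))
    (hAB : 2 ≤ dist A B) (hCA : 2 ≤ dist C A)
    (hB : dist A B ≤ dist B C) (hC : dist C A ≤ dist B C) (hangle : ∠ B A C < 2 * π / 3)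
    (harea : volume (convexHull ℝ ({A, B, C} : Set (EuclideanSpace ℝ (Fin 2)))) ≤
      ENNReal.ofReal (√3)) :
    dist A B = 2 ∧ dist B C = 2 ∧ dist C A = 2 := by
  have hcross : |(B - A) 0 * (C - A) 1 - (B - A) 1 * (C - A) 0| ≤ 2 * √3 := by
    have := (ofReal_abs_cross_le_two_mul_volume_convexHull A B C).trans
      (mul_le_mul_right harea 2)
    rw [show (2 : ENNReal) * ENNReal.ofReal (√3) = ENNReal.ofReal (2 * √3) by
      rw [ENNReal.ofReal_mul (by norm_num), ENNReal.ofReal_ofNat]] at this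
    exact (ENNReal.ofReal_le_ofReal_iff (by positivity)).1 this
  have hcos : -(1 / 2) < cos (∠ B A C) := by
    have h := cos_lt_cos_of_nonneg_of_le_pi (angle_nonneg B A C)
      (by linarith [pi_pos]) hangle
    have h' : cos (2 * π / 3) = -(1 / 2) := by
      rw [show 2 * π / 3 = π - π / 3 by ring, cos_pi_sub, cos_pi_div_three]
    rwa [h'] at h
  have hlaw := law_cos B A C
  rw [dist_comm B A] at hlaw
  have hinner : cos (∠ B A C) * (dist A B * dist C A) =
      (B - A) 0 * (C - A) 0 + (B - A) 1 * (C - A) 1 := by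
    have := InnerProductGeometry.cos_angle_mul_norm_mul_norm (B - A) (C - A)
    rw [← dist_eq_norm, ← dist_eq_norm, dist_comm B A] at this
    refine this.trans ?_
    simp [PiLp.inner_apply, Fin.sum_univ_two, mul_comm]
  have hc : dist A B ^ 2 = (B - A) 0 ^ 2 + (B - A) 1 ^ 2 := by
    rw [dist_comm, dist_eq_norm, EuclideanSpace.real_norm_sq_eq, Fin.sum_univ_two]
  have hb : dist C A ^ 2 = (C - A) 0 ^ 2 + (C - A) 1 ^ 2 := by
    rw [dist_eq_norm, EuclideanSpace.real_norm_sq_eq, Fin.sum_univ_two]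
  have hcross_sq : ((B - A) 0 * (C - A) 1 - (B - A) 1 * (C - A) 0) ^ 2 ≤ 12 := by
    have := pow_le_pow_left₀ (abs_nonneg _) hcross 2
    rw [sq_abs, mul_pow, sq_sqrt (by norm_num)] at this
    linarith
  generalize (B - A) 0 = u₀ at *
  generalize (B - A) 1 = u₁ at *
  generalize (C - A) 0 = v₀ at *
  generalize (C - A) 1 = v₁ at *
  generalize cos (∠ B A C) = k at *
  generalize dist A B = c at *
  generalize dist C A = b at *
  generalize dist B C = a at *
  have hlagrange : (u₀ * v₁ - u₁ * v₀) ^ 2 = (c * b) ^ 2 * (1 - k ^ 2) := by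
    have : (c * b) ^ 2 * (1 - k ^ 2) = c ^ 2 * b ^ 2 - (k * (c * b)) ^ 2 := by ring
    rw [this, hinner, hc, hb]
    ring
  rw [hlagrange] at hcross_sq
  have hk : k ≤ 1 / 2 := by
    rcases le_total b c with hbc | hbc
    · have : k * (c * b) * 2 ≤ b * b := by nlinarith
      by_contra! hlt
      nlinarith [mul_pos (show 0 < c by linarith) (show 0 < b by linarith)]
    · have : k * (c * b) * 2 ≤ c * c := by nlinarith
      by_contra! hlt
      nlinarith [mul_pos (show 0 < c by linarith) (show 0 < b by linarith)]
  have hk2 : 3 / 4 ≤ 1 - k ^ 2 := by nlinarith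
  have hcb : c * b ≤ 4 := by
    have : (c * b) ^ 2 ≤ 4 ^ 2 := by nlinarith [sq_nonneg (c * b)]
    exact le_of_sq_le_sq this (by norm_num)
  have hc2 : c = 2 := by nlinarith
  have hb2 : b = 2 := by nlinarith
  subst hc2 hb2
  have hk' : k = 1 / 2 := by nlinarith
  subst hk'
  exact ⟨rfl, by nlinarith, rfl⟩

theorem equilateral_of_area_eq_sqrt_three
    (A B C : EuclideanSpace ℝ (Fin 2))
    (h : AffineIndependent ℝ ![A, B, C])
    (hAB : 2 ≤ dist A B) (hBC : 2 ≤ dist B C) (hCA : 2 ≤ dist C A)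
    (hangle : max (∠ B A C) (max (∠ A B C) (∠ B C A)) < 2 * π / 3)
    (harea : volume (convexHull ℝ ({A, B, C} : Set (EuclideanSpace ℝ (Fin 2)))) =
      ENNReal.ofReal (Real.sqrt 3)) :
    dist A B = 2 ∧ dist B C = 2 ∧ dist C A = 2 := by
  obtain ⟨hA, hB, hC⟩ : ∠ B A C < 2 * π / 3 ∧ ∠ A B C < 2 * π / 3 ∧ ∠ B C A < 2 * π / 3 := by
    simpa only [max_lt_iff] using hangle
  have hBCA : ({B, C, A} : Set (EuclideanSpace ℝ (Fin 2))) = {A, B, C} := by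
    ext; simp; tauto
  have hCAB : ({C, A, B} : Set (EuclideanSpace ℝ (Fin 2))) = {A, B, C} := by
    ext; simp; tauto
  by_cases h₁ : dist A B ≤ dist B C ∧ dist C A ≤ dist B C
  · exact dist_eq_two_of_volume_convexHull_le A B C hAB hCA h₁.1 h₁.2 hA harea.le
  by_cases h₂ : dist B C ≤ dist C A ∧ dist A B ≤ dist C A
  · have := dist_eq_two_of_volume_convexHull_le B C A hBC hAB h₂.1 h₂.2
      (by rwa [EuclideanGeometry.angle_comm]) (by rw [hBCA, harea])
    tauto
  · have h₃ : dist C A ≤ dist A B ∧ dist B C ≤ dist A B := by grind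
    have := dist_eq_two_of_volume_convexHull_le C A B hCA hBC h₃.1 h₃.2
      (by rwa [EuclideanGeometry.angle_comm]) (by rw [hCAB, harea])
    tauto
end

section
/- Let S be a saturated circle configuration in the Euclidean plane, and let A, B, C ∈ S be affinely independent points such that the triangle ABC satisfies the Delaunay (empty circumdisk) condition: every point p ∈ S is at distance at least the circumradius R from the circumcenter O of ABC. Then the 'density' (π/2) / area(ABC) of the triangle is at most π/√12; equivalently, area(ABC) ≥ √3. Equality holds if and only if the triangle is equilateral with side length 2. -/
open Real EuclideanGeometry MeasureTheory

theorem volume_unitTriangle_prod :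
    volume {p : ℝ × ℝ | 0 ≤ p.1 ∧ 0 ≤ p.2 ∧ p.1 + p.2 ≤ 1} = ENNReal.ofReal (1 / 2) := by
  have hmeas : MeasurableSet {p : ℝ × ℝ | 0 ≤ p.1 ∧ 0 ≤ p.2 ∧ p.1 + p.2 ≤ 1} := by
    measurability
  rw [Measure.volume_eq_prod, Measure.prod_apply hmeas]
  have hsec : ∀ x : ℝ, volume (Prod.mk x ⁻¹' {p : ℝ × ℝ | 0 ≤ p.1 ∧ 0 ≤ p.2 ∧ p.1 + p.2 ≤ 1}) =
      (Set.Icc (0 : ℝ) 1).indicator (fun x => ENNReal.ofReal (1 - x)) x := by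
    intro x
    by_cases hx : x ∈ Set.Icc (0 : ℝ) 1
    · have : Prod.mk x ⁻¹' {p : ℝ × ℝ | 0 ≤ p.1 ∧ 0 ≤ p.2 ∧ p.1 + p.2 ≤ 1} =
          Set.Icc 0 (1 - x) := by
        ext y
        simp only [Set.mem_preimage, Set.mem_ofPred_eq, Set.mem_Icc]
        constructor
        · rintro ⟨-, h₁, h₂⟩; exact ⟨h₁, by linarith⟩
        · rintro ⟨h₁, h₂⟩; exact ⟨hx.1, h₁, by linarith⟩
      rw [this, Set.indicator_of_mem hx, Real.volume_Icc, sub_zero]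
    · have : Prod.mk x ⁻¹' {p : ℝ × ℝ | 0 ≤ p.1 ∧ 0 ≤ p.2 ∧ p.1 + p.2 ≤ 1} = ∅ := by
        ext y
        simp only [Set.mem_preimage, Set.mem_ofPred_eq, Set.mem_empty_iff_false, iff_false]
        rintro ⟨h₀, h₁, h₂⟩
        exact hx ⟨h₀, by linarith⟩
      rw [this, Set.indicator_of_notMem hx, measure_empty]
  simp_rw [hsec]
  rw [lintegral_indicator measurableSet_Icc,
    ← ofReal_integral_eq_lintegral_ofReal
      (Continuous.integrableOn_Icc (by fun_prop))
      ((ae_restrict_mem measurableSet_Icc).mono fun x hx => sub_nonneg.2 hx.2),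
    integral_Icc_eq_integral_Ioc, ← intervalIntegral.integral_of_le zero_le_one]
  congr 1
  rw [intervalIntegral.integral_sub (by simp) (by simp)]
  norm_num

theorem volume_unitTriangle :
    volume {x : EuclideanSpace ℝ (Fin 2) | 0 ≤ x 0 ∧ 0 ≤ x 1 ∧ x 0 + x 1 ≤ 1} =
      ENNReal.ofReal (1 / 2) := by
  have hmeas : MeasurableSet {p : ℝ × ℝ | 0 ≤ p.1 ∧ 0 ≤ p.2 ∧ p.1 + p.2 ≤ 1} := by
    measurability
  rw [← volume_unitTriangle_prod,
    ← ((volume_preserving_finTwoArrow ℝ).comp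
      (PiLp.volume_preserving_ofLp (Fin 2))).measure_preimage hmeas.nullMeasurableSet]
  rfl

theorem convexHull_triple_eq_image {E : Type*} [AddCommGroup E] [Module ℝ E] (A B C : E) :
    convexHull ℝ {A, B, C} =
      (fun v : E => A + v) '' ((fun x : EuclideanSpace ℝ (Fin 2) => x 0 • (B - A) + x 1 • (C - A)) ''
        {x | 0 ≤ x 0 ∧ 0 ≤ x 1 ∧ x 0 + x 1 ≤ 1}) := by
  rw [Set.image_image]
  apply Set.Subset.antisymm
  · apply convexHull_min
    · rintro p (rfl | rfl | rfl)
      · exact ⟨!₂[0, 0], by simp, by simp⟩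
      · exact ⟨!₂[1, 0], by simp, by simp⟩
      · exact ⟨!₂[0, 1], by simp, by simp⟩
    · rintro _ ⟨x, ⟨hx₀, hx₁, hx₂⟩, rfl⟩ _ ⟨y, ⟨hy₀, hy₁, hy₂⟩, rfl⟩ a b ha hb hab
      refine ⟨a • x + b • y, ⟨?_, ?_, ?_⟩, ?_⟩
      · simp only [PiLp.add_apply, PiLp.smul_apply, smul_eq_mul]; positivity
      · simp only [PiLp.add_apply, PiLp.smul_apply, smul_eq_mul]; positivity
      · simp only [PiLp.add_apply, PiLp.smul_apply, smul_eq_mul]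
        nlinarith
      · obtain rfl : b = 1 - a := by linarith
        simp only [PiLp.add_apply, PiLp.smul_apply, smul_eq_mul]
        module
  · rintro _ ⟨x, ⟨hx₀, hx₁, hx₂⟩, rfl⟩
    have := (convex_convexHull ℝ {A, B, C}).sum_mem (t := Finset.univ)
      (w := ![1 - x 0 - x 1, x 0, x 1]) (z := ![A, B, C])
      (by intro i _; fin_cases i <;> simp <;> linarith)
      (by simp [Fin.sum_univ_three]; ring)
      (by intro i _; apply subset_convexHull; fin_cases i <;> simp)
    convert this using 1
    simp [Fin.sum_univ_three]
    module

theorem volume_convexHull_triple (A B C : EuclideanSpace ℝ (Fin 2)) :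
    (volume (convexHull ℝ {A, B, C})).toReal =
      |(B 0 - A 0) * (C 1 - A 1) - (B 1 - A 1) * (C 0 - A 0)| / 2 := by
  set M : Matrix (Fin 2) (Fin 2) ℝ := !![B 0 - A 0, C 0 - A 0; B 1 - A 1, C 1 - A 1] with hM
  have himage : (fun x : EuclideanSpace ℝ (Fin 2) => x 0 • (B - A) + x 1 • (C - A)) =
      Matrix.toLin (EuclideanSpace.basisFun (Fin 2) ℝ).toBasis
        (EuclideanSpace.basisFun (Fin 2) ℝ).toBasis M := by
    funext x
    rw [Matrix.toLin_apply]
    ext i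
    fin_cases i <;> simp [hM, Matrix.mulVec, dotProduct, Fin.sum_univ_two] <;> ring
  rw [convexHull_triple_eq_image, himage, Set.image_add_left, measure_preimage_add,
    Measure.addHaar_image_linearMap, volume_unitTriangle, LinearMap.det_toLin,
    ← ENNReal.ofReal_mul (abs_nonneg _), ENNReal.toReal_ofReal (by positivity),
    Matrix.det_fin_two_of]
  rw [mul_comm (C 0 - A 0)]
  ring

/-- A lower bound for `16 * area ^ 2`, given by Heron's formula in terms of the squared side lengths
`x ≤ y ≤ z`, when the circumradius is less than `2`. -/
theorem heron_bound_of_le {x y z : ℝ} (hx : 4 ≤ x) (hxy : x ≤ y) (hyz : y ≤ z)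
    (hR : x * y * z < 4 * (2 * x * y + 2 * y * z + 2 * z * x - x ^ 2 - y ^ 2 - z ^ 2)) :
    48 ≤ 2 * x * y + 2 * y * z + 2 * z * x - x ^ 2 - y ^ 2 - z ^ 2 ∧
      (2 * x * y + 2 * y * z + 2 * z * x - x ^ 2 - y ^ 2 - z ^ 2 = 48 →
        x = 4 ∧ y = 4 ∧ z = 4) := by
  set D := 2 * x * y + 2 * y * z + 2 * z * x - x ^ 2 - y ^ 2 - z ^ 2 with hD
  have hz : z * (16 - z) ≤ D := by
    have h₁ : 0 ≤ (x - 4) * (2 * y + 2 * z - x - 4) :=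
      mul_nonneg (by linarith) (by linarith)
    have h₂ : 0 ≤ (y - 4) * (2 * z + 4 - y) := mul_nonneg (by linarith) (by linarith)
    linarith
  have hz' : D ≤ 48 → z < 12 := by
    intro h
    have h₁ : 16 ≤ x * y := by nlinarith
    have h₂ : 16 * z ≤ x * y * z := mul_le_mul_of_nonneg_right h₁ (by linarith)
    linarith
  constructor
  · by_contra! h
    nlinarith [hz' h.le]
  · intro h
    have hz4 : z = 4 := by nlinarith [hz' h.le]
    refine ⟨?_, ?_, ?_⟩ <;> linarith

theorem heron_bound {x y z : ℝ} (hx : 4 ≤ x) (hy : 4 ≤ y) (hz : 4 ≤ z)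
    (hR : x * y * z < 4 * (2 * x * y + 2 * y * z + 2 * z * x - x ^ 2 - y ^ 2 - z ^ 2)) :
    48 ≤ 2 * x * y + 2 * y * z + 2 * z * x - x ^ 2 - y ^ 2 - z ^ 2 ∧
      (2 * x * y + 2 * y * z + 2 * z * x - x ^ 2 - y ^ 2 - z ^ 2 = 48 →
        x = 4 ∧ y = 4 ∧ z = 4) := by
  have key : ∀ {a b c : ℝ}, 4 ≤ a → a ≤ b → b ≤ c →
      a * b * c = x * y * z →
      2 * a * b + 2 * b * c + 2 * c * a - a ^ 2 - b ^ 2 - c ^ 2 =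
        2 * x * y + 2 * y * z + 2 * z * x - x ^ 2 - y ^ 2 - z ^ 2 → x + y + z = a + b + c →
      48 ≤ 2 * x * y + 2 * y * z + 2 * z * x - x ^ 2 - y ^ 2 - z ^ 2 ∧
      (2 * x * y + 2 * y * z + 2 * z * x - x ^ 2 - y ^ 2 - z ^ 2 = 48 →
        x = 4 ∧ y = 4 ∧ z = 4) := by
    intro a b c ha hab hbc hprod hheron hsum
    rw [← hprod, ← hheron] at hR
    obtain ⟨h₁, h₂⟩ := heron_bound_of_le ha hab hbc hR
    rw [hheron] at h₁ h₂
    refine ⟨h₁, fun h => ?_⟩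
    obtain ⟨h₃, h₄, h₅⟩ := h₂ h
    refine ⟨?_, ?_, ?_⟩ <;> linarith
  rcases le_total x y with hxy | hxy <;> rcases le_total y z with hyz | hyz <;>
    rcases le_total x z with hxz | hxz
  · exact key hx hxy hyz rfl rfl rfl
  · exact key hx hxy hyz rfl rfl rfl
  · exact key hx hxz hyz (by ring) (by ring) (by ring)
  · exact key hz hxz hxy (by ring) (by ring) (by ring)
  · exact key hy hxy hxz (by ring) (by ring) (by ring)
  · exact key hy hyz hxz (by ring) (by ring) (by ring)
  · exact key hz hyz hxy (by ring) (by ring) (by ring)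
  · exact key hz hyz hxy (by ring) (by ring) (by ring)

theorem dist_sq_eq_fin_two (P Q : EuclideanSpace ℝ (Fin 2)) :
    dist P Q ^ 2 = (P 0 - Q 0) ^ 2 + (P 1 - Q 1) ^ 2 := by
  rw [EuclideanSpace.dist_sq_eq, Fin.sum_univ_two, Real.dist_eq, Real.dist_eq, sq_abs, sq_abs]

/-- The relation `a * b * c = 4 * R * area`, squared. -/
theorem prod_dist_sq_eq_of_dist_eq {A B C O : EuclideanSpace ℝ (Fin 2)} {R : ℝ}
    (hA : dist A O = R) (hB : dist B O = R) (hC : dist C O = R) :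
    dist A B ^ 2 * dist B C ^ 2 * dist C A ^ 2 =
      R ^ 2 * (4 * ((B 0 - A 0) * (C 1 - A 1) - (B 1 - A 1) * (C 0 - A 0)) ^ 2) := by
  have hA' := dist_sq_eq_fin_two A O
  have hB' := dist_sq_eq_fin_two B O
  have hC' := dist_sq_eq_fin_two C O
  rw [hA] at hA'
  rw [hB] at hB'
  rw [hC] at hC'
  simp only [dist_sq_eq_fin_two]
  obtain ⟨p, hp⟩ : ∃ p, p = B 0 - A 0 := ⟨_, rfl⟩
  obtain ⟨q, hq⟩ : ∃ q, q = B 1 - A 1 := ⟨_, rfl⟩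
  obtain ⟨s, hs⟩ : ∃ s, s = C 0 - A 0 := ⟨_, rfl⟩
  obtain ⟨t, ht⟩ : ∃ t, t = C 1 - A 1 := ⟨_, rfl⟩
  obtain ⟨u, hu⟩ : ∃ u, u = O 0 - A 0 := ⟨_, rfl⟩
  obtain ⟨v, hv⟩ : ∃ v, v = O 1 - A 1 := ⟨_, rfl⟩
  rw [show B 0 = p + A 0 by linarith, show B 1 = q + A 1 by linarith,
    show O 0 = u + A 0 by linarith, show O 1 = v + A 1 by linarith] at hB'
  rw [show C 0 = s + A 0 by linarith, show C 1 = t + A 1 by linarith,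
    show O 0 = u + A 0 by linarith, show O 1 = v + A 1 by linarith] at hC'
  rw [show O 0 = u + A 0 by linarith, show O 1 = v + A 1 by linarith] at hA'
  rw [show B 0 = p + A 0 by linarith, show B 1 = q + A 1 by linarith,
    show C 0 = s + A 0 by linarith, show C 1 = t + A 1 by linarith, hA']
  have hb : 2 * (p * u + q * v) = p ^ 2 + q ^ 2 := by linarith
  have hc : 2 * (s * u + t * v) = s ^ 2 + t ^ 2 := by linarith
  have h₀ : 2 * (p * t - q * s) * u = (p ^ 2 + q ^ 2) * t - (s ^ 2 + t ^ 2) * q := by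
    linear_combination t * hb - q * hc
  have h₁ : 2 * (p * t - q * s) * v = (s ^ 2 + t ^ 2) * p - (p ^ 2 + q ^ 2) * s := by
    linear_combination p * hc - s * hb
  have h₀' := congrArg (· ^ 2) h₀
  have h₁' := congrArg (· ^ 2) h₁
  linear_combination -h₀' - h₁'

theorem delaunay_density_le
    (S : Set (EuclideanSpace ℝ (Fin 2)))
    (hpack : ∀ p ∈ S, ∀ q ∈ S, p ≠ q → 2 ≤ dist p q)
    (hsat : ∀ x : EuclideanSpace ℝ (Fin 2), ∃ p ∈ S, dist x p < 2)
    (A B C : EuclideanSpace ℝ (Fin 2)) (hA : A ∈ S) (hB : B ∈ S) (hC : C ∈ S)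
    (h : AffineIndependent ℝ ![A, B, C])
    (hdel : ∀ p ∈ S,
      (⟨![A, B, C], h⟩ : Affine.Triangle ℝ (EuclideanSpace ℝ (Fin 2))).circumradius ≤
        dist p (⟨![A, B, C], h⟩ : Affine.Triangle ℝ (EuclideanSpace ℝ (Fin 2))).circumcenter) :
    (π / 2) / (volume (convexHull ℝ ({A, B, C} : Set (EuclideanSpace ℝ (Fin 2))))).toReal ≤
        π / Real.sqrt 12 ∧
    Real.sqrt 3 ≤ (volume (convexHull ℝ ({A, B, C} : Set (EuclideanSpace ℝ (Fin 2))))).toReal ∧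
    ((volume (convexHull ℝ ({A, B, C} : Set (EuclideanSpace ℝ (Fin 2))))).toReal = Real.sqrt 3 ↔
      dist A B = 2 ∧ dist B C = 2 ∧ dist C A = 2) := by
  set T : Affine.Triangle ℝ (EuclideanSpace ℝ (Fin 2)) := ⟨![A, B, C], h⟩
  have hinj := h.injective
  have hAB : A ≠ B := fun e => by simpa using hinj (a₁ := 0) (a₂ := 1) e
  have hBC : B ≠ C := fun e => by simpa using hinj (a₁ := 1) (a₂ := 2) e
  have hCA : C ≠ A := fun e => by simpa using hinj (a₁ := 2) (a₂ := 0) e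
  have hR : T.circumradius < 2 := by
    obtain ⟨p, hp, hlt⟩ := hsat T.circumcenter
    exact (hdel p hp).trans_lt (by rwa [dist_comm])
  have hR₀ : 0 < T.circumradius := T.circumradius_pos
  have four_le : ∀ {P Q}, P ∈ S → Q ∈ S → P ≠ Q → 4 ≤ dist P Q ^ 2 := fun hP hQ hPQ => by
    nlinarith [hpack _ hP _ hQ hPQ]
  have hprod := prod_dist_sq_eq_of_dist_eq
    (T.dist_circumcenter_eq_circumradius 0) (T.dist_circumcenter_eq_circumradius 1)
    (T.dist_circumcenter_eq_circumradius 2)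
  change dist A B ^ 2 * dist B C ^ 2 * dist C A ^ 2 = _ * (4 * ((B 0 - A 0) * (C 1 - A 1) -
    (B 1 - A 1) * (C 0 - A 0)) ^ 2) at hprod
  have hvol := volume_convexHull_triple A B C
  set K := (volume (convexHull ℝ ({A, B, C} : Set (EuclideanSpace ℝ (Fin 2))))).toReal
  have hK₀ : 0 ≤ K := ENNReal.toReal_nonneg
  have hK : (4 * K) ^ 2 =
      4 * ((B 0 - A 0) * (C 1 - A 1) - (B 1 - A 1) * (C 0 - A 0)) ^ 2 := by
    rw [hvol, ← sq_abs ((B 0 - A 0) * (C 1 - A 1) - (B 1 - A 1) * (C 0 - A 0))]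
    ring
  rw [← hK] at hprod
  have hheron : (4 * K) ^ 2 = 2 * dist A B ^ 2 * dist B C ^ 2 + 2 * dist B C ^ 2 * dist C A ^ 2 +
      2 * dist C A ^ 2 * dist A B ^ 2 - (dist A B ^ 2) ^ 2 - (dist B C ^ 2) ^ 2 -
      (dist C A ^ 2) ^ 2 := by
    rw [hK]
    simp only [dist_sq_eq_fin_two]
    ring
  have hx := four_le hA hB hAB
  have hy := four_le hB hC hBC
  have hz := four_le hC hA hCA
  have hpos : 0 < (4 * K) ^ 2 := by
    have : 0 < dist A B ^ 2 * dist B C ^ 2 * dist C A ^ 2 := by positivity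
    rw [hprod] at this
    exact pos_of_mul_pos_right this (sq_nonneg _)
  obtain ⟨h₁, h₂⟩ := heron_bound hx hy hz (by
    rw [hprod, ← hheron]
    exact mul_lt_mul_of_pos_right (by nlinarith) hpos)
  rw [← hheron] at h₁ h₂
  have harea : √3 ≤ K := Real.sqrt_le_iff.2 ⟨hK₀, by linarith⟩
  refine ⟨?_, harea, fun hK3 => ?_, fun ⟨hab, hbc, hca⟩ => ?_⟩
  · rw [div_div, show (12 : ℝ) = 2 ^ 2 * 3 by norm_num, Real.sqrt_mul (by norm_num),
      Real.sqrt_sq (by norm_num)]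
    gcongr
  · have hsq : (4 * K) ^ 2 = 48 := by
      rw [hK3, mul_pow, Real.sq_sqrt (by norm_num)]
      norm_num
    obtain ⟨h₃, h₄, h₅⟩ := h₂ hsq
    have eq_two : ∀ {d : ℝ}, 0 ≤ d → d ^ 2 = 4 → d = 2 := fun hd h => by nlinarith
    exact ⟨eq_two dist_nonneg h₃, eq_two dist_nonneg h₄, eq_two dist_nonneg h₅⟩
  · rw [hab, hbc, hca] at hheron
    exact ((Real.sqrt_eq_iff_eq_sq (by norm_num) hK₀).2 (by linarith)).symm
end

section
/- Let A, B, C be three affinely independent points in the Euclidean plane with all three side lengths at least 2 and circumradius at most 2. Then the distance from each vertex to the line through the other two vertices (the altitude from that vertex) is at least 1. -/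
open Real EuclideanGeometry Metric

/-- The altitude from `A` onto the line `BC` is at least `AC · sin ∠ACB`. -/
lemma dist_mul_sin_angle_le_infDist_affineSpan_pair {V P : Type*} [NormedAddCommGroup V]
    [InnerProductSpace ℝ V] [MetricSpace P] [NormedAddTorsor V P] {A B C : P} (hBC : B ≠ C) :
    dist A C * Real.sin (∠ A C B) ≤ infDist A (affineSpan ℝ ({B, C} : Set P) : Set P) := by
  rw [le_infDist ⟨B, left_mem_affineSpan_pair ℝ B C⟩]
  intro x hx
  rw [SetLike.mem_coe, Set.pair_comm, mem_affineSpan_pair_iff_exists_lineMap_eq] at hx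
  obtain ⟨t, rfl⟩ := hx
  set u := A -ᵥ C with hu
  set v := B -ᵥ C with hv
  have hd : dist A (AffineMap.lineMap C B t) = ‖u - t • v‖ := by
    rw [dist_eq_norm_vsub V, AffineMap.lineMap_apply, vsub_vadd_eq_vsub_sub]
  have hv0 : 0 < ‖v‖ := norm_pos_iff.2 (vsub_ne_zero.2 hBC)
  rw [hd, dist_eq_norm_vsub V A C, EuclideanGeometry.angle, ← hu, ← hv]
  refine le_of_mul_le_mul_right ?_ hv0
  have hs := InnerProductGeometry.sin_angle_mul_norm_mul_norm u v
  calc ‖u‖ * Real.sin (InnerProductGeometry.angle u v) * ‖v‖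
      = √(inner ℝ u u * inner ℝ v v - inner ℝ u v * inner ℝ u v) := by rw [← hs]; ring
    _ ≤ ‖u - t • v‖ * ‖v‖ := by
      refine Real.sqrt_le_iff.2 ⟨by positivity, ?_⟩
      rw [mul_pow, norm_sub_sq_real, inner_smul_right, norm_smul, Real.norm_eq_abs, mul_pow,
        sq_abs, real_inner_self_eq_norm_sq, real_inner_self_eq_norm_sq]
      nlinarith [sq_nonneg (t * ‖v‖ ^ 2 - inner ℝ u v)]

/-- In a triangle with circumradius at most `2` and two sides of length at least `2`, the altitude
from their common vertex is at least `1`. -/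
lemma Affine.Simplex.one_le_infDist_of_circumradius_le_two {V P : Type*} [NormedAddCommGroup V]
    [InnerProductSpace ℝ V] [MetricSpace P] [NormedAddTorsor V P] (T : Affine.Triangle ℝ P)
    {i j k : Fin 3} (hij : i ≠ j) (hik : i ≠ k) (hjk : j ≠ k) (hR : T.circumradius ≤ 2)
    (hdij : 2 ≤ dist (T.points i) (T.points j)) (hdik : 2 ≤ dist (T.points i) (T.points k)) :
    1 ≤ infDist (T.points i)
      (affineSpan ℝ ({T.points j, T.points k} : Set P) : Set P) := by
  refine le_trans ?_
    (dist_mul_sin_angle_le_infDist_affineSpan_pair (T.independent.injective.ne hjk))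
  have hs := T.dist_div_sin_angle_eq_two_mul_circumradius hik hij hjk.symm
  have hsin : 0 ≤ Real.sin (∠ (T.points i) (T.points k) (T.points j)) :=
    InnerProductGeometry.sin_angle_nonneg _ _
  rcases hsin.eq_or_lt with h0 | hpos
  · rw [← h0, div_zero] at hs
    linarith [T.circumradius_pos]
  · rw [div_eq_iff hpos.ne'] at hs
    nlinarith

theorem altitudes_ge_one
    (A B C : EuclideanSpace ℝ (Fin 2))
    (h : AffineIndependent ℝ ![A, B, C])
    (hAB : 2 ≤ dist A B) (hBC : 2 ≤ dist B C) (hCA : 2 ≤ dist C A)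
    (hR : (⟨![A, B, C], h⟩ : Affine.Triangle ℝ (EuclideanSpace ℝ (Fin 2))).circumradius ≤ 2) :
    1 ≤ Metric.infDist A (affineSpan ℝ ({B, C} : Set (EuclideanSpace ℝ (Fin 2))) : Set (EuclideanSpace ℝ (Fin 2))) ∧
    1 ≤ Metric.infDist B (affineSpan ℝ ({C, A} : Set (EuclideanSpace ℝ (Fin 2))) : Set (EuclideanSpace ℝ (Fin 2))) ∧
    1 ≤ Metric.infDist C (affineSpan ℝ ({A, B} : Set (EuclideanSpace ℝ (Fin 2))) : Set (EuclideanSpace ℝ (Fin 2))) := by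
  let T : Affine.Triangle ℝ (EuclideanSpace ℝ (Fin 2)) := ⟨![A, B, C], h⟩
  refine ⟨?_, ?_, ?_⟩
  · exact T.one_le_infDist_of_circumradius_le_two (i := 0) (j := 1) (k := 2)
      (by decide) (by decide) (by decide) hR hAB (hCA.trans_eq (dist_comm C A))
  · exact T.one_le_infDist_of_circumradius_le_two (i := 1) (j := 2) (k := 0)
      (by decide) (by decide) (by decide) hR hBC (hAB.trans_eq (dist_comm A B))
  · exact T.one_le_infDist_of_circumradius_le_two (i := 2) (j := 0) (k := 1)
      (by decide) (by decide) (by decide) hR hCA (hBC.trans_eq (dist_comm B C))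
end

section
/- Let A, B, C be three affinely independent points in the Euclidean plane with all three side lengths at least 2 and circumradius strictly less than 2. Then the 2-dimensional Lebesgue measure of the intersection of the union of the three open unit balls centered at A, B and C with the convex hull of {A, B, C} is at most (π/√12) times the area of the convex hull of {A, B, C}. -/
open Real EuclideanGeometry MeasureTheory Metric

/-- Three open cones which, up to reflection, are the vertex cones of a triangle, together meet the
unit ball in at most half of its area. -/
theorem volume_ball_inter_cones_le (f g : EuclideanSpace ℝ (Fin 2) →L[ℝ] ℝ) :
    volume (ball 0 1 ∩ {x | 0 < f x ∧ 0 < g x}) +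
      volume (ball 0 1 ∩ {x | g x < 0 ∧ 0 < f x + g x}) +
      volume (ball 0 1 ∩ {x | f x < 0 ∧ 0 < f x + g x}) ≤ ENNReal.ofReal (π / 2) := by
  have hf : Continuous f := f.continuous
  have hg : Continuous g := g.continuous
  set H : Set (EuclideanSpace ℝ (Fin 2)) := ball 0 1 ∩ {x | 0 < f x + g x}
  have hHm : MeasurableSet H :=
    (isOpen_ball.inter (isOpen_lt continuous_const (hf.add hg))).measurableSet
  have hcones : volume (ball 0 1 ∩ {x | 0 < f x ∧ 0 < g x}) +
      volume (ball 0 1 ∩ {x | g x < 0 ∧ 0 < f x + g x}) +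
      volume (ball 0 1 ∩ {x | f x < 0 ∧ 0 < f x + g x}) ≤ volume H := by
    rw [← measure_union, ← measure_union]
    · refine measure_mono ?_
      rintro x ((⟨hx, h1, h2⟩ | ⟨hx, h1, h2⟩) | ⟨hx, h1, h2⟩)
      exacts [⟨hx, add_pos h1 h2⟩, ⟨hx, h2⟩, ⟨hx, h2⟩]
    · rw [Set.disjoint_left]
      rintro x (⟨-, h1, h2⟩ | ⟨-, h1, h2⟩) ⟨-, h3, h4⟩
      · exact lt_asymm h1 h3
      · linarith
    · exact (isOpen_ball.inter ((isOpen_lt hf continuous_const).inter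
        (isOpen_lt continuous_const (hf.add hg)))).measurableSet
    · rw [Set.disjoint_left]
      rintro x ⟨-, h1, h2⟩ ⟨-, h3, h4⟩
      exact lt_asymm h2 h3
    · exact (isOpen_ball.inter ((isOpen_lt hg continuous_const).inter
        (isOpen_lt continuous_const (hf.add hg)))).measurableSet
  have hhalf : volume H + volume H ≤ ENNReal.ofReal π := by
    nth_rewrite 2 [← Measure.measure_neg volume H]
    rw [← measure_union _ hHm.neg]
    · refine (measure_mono (t := ball 0 1) ?_).trans_eq
        (by rw [EuclideanSpace.volume_ball_fin_two]; simp)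
      rintro x (⟨hx, -⟩ | ⟨hx, -⟩)
      · exact hx
      · simpa using hx
    · rw [Set.disjoint_left]
      rintro x ⟨-, h1⟩ ⟨-, h2⟩
      simp only [Set.mem_ofPred_eq, map_neg] at h1 h2
      linarith
  refine hcones.trans ?_
  rw [ENNReal.ofReal_div_of_pos two_pos, ENNReal.le_div_iff_mul_le (by simp) (by simp),
    ENNReal.ofReal_ofNat, mul_two]
  exact hhalf

/-- The area of a triangle is at least half the area of the parallelogram on two of its sides. -/
theorem ofReal_abs_det_le_two_mul_volume_convexHull (A B C : EuclideanSpace ℝ (Fin 2)) :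
    ENNReal.ofReal |(B 0 - A 0) * (C 1 - A 1) - (B 1 - A 1) * (C 0 - A 0)| ≤
      2 * volume (convexHull ℝ ({A, B, C} : Set (EuclideanSpace ℝ (Fin 2)))) := by
  set T := convexHull ℝ ({A, B, C} : Set (EuclideanSpace ℝ (Fin 2)))
  have hconv : Convex ℝ T := convex_convexHull ℝ _
  have hTm : NullMeasurableSet T volume := hconv.nullMeasurableSet volume
  have hmem : ∀ s t : ℝ, 0 ≤ s → 0 ≤ t → s + t ≤ 1 → A + (s • (B - A) + t • (C - A)) ∈ T := by
    intro s t hs ht hst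
    have := hconv.sum_mem (t := Finset.univ) (w := ![1 - s - t, s, t]) (z := ![A, B, C])
      (by intro i _; fin_cases i <;> simp <;> linarith)
      (by simp [Fin.sum_univ_three]; ring)
      (by intro i _; apply subset_convexHull; fin_cases i <;> simp)
    convert this using 1
    simp only [Fin.sum_univ_three, Matrix.cons_val]
    module
  have hP : volume (parallelepiped ![B - A, C - A]) =
      ENNReal.ofReal |(B 0 - A 0) * (C 1 - A 1) - (B 1 - A 1) * (C 0 - A 0)| := by
    rw [← (EuclideanSpace.basisFun (Fin 2) ℝ).addHaar_eq_volume, Measure.addHaar_parallelepiped,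
      Module.Basis.det_apply, Matrix.det_fin_two]
    congr 2
    simp [Module.Basis.toMatrix_apply]
    ring
  rw [← hP, two_mul]
  nth_rewrite 1 [← (measurePreserving_add_left volume A).measure_preimage hTm]
  rw [← (Measure.measurePreserving_sub_left volume (A + ((B - A) + (C - A)))).measure_preimage hTm]
  refine (measure_mono ?_).trans (measure_union_le _ _)
  intro x hx
  obtain ⟨t, ⟨h0, h1⟩, rfl⟩ := (mem_parallelepiped_iff _ _).1 hx
  have h00 := h0 0
  have h01 := h0 1
  have h10 := h1 0
  have h11 := h1 1
  simp only [Pi.zero_apply, Pi.one_apply] at h00 h01 h10 h11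
  simp only [Fin.sum_univ_two, Matrix.cons_val_zero, Matrix.cons_val_one]
  rcases le_total (t 0 + t 1) 1 with h | h
  · exact Or.inl (hmem _ _ h00 h01 h)
  · right
    have := hmem (1 - t 0) (1 - t 1) (by linarith) (by linarith) (by linarith)
    rw [Set.mem_preimage]
    convert this using 1
    module

/-- The area of a triangle meeting the three unit balls at its vertices is at most `π / 2`. -/
theorem volume_balls_inter_convexHull_le (A B C : EuclideanSpace ℝ (Fin 2))
    (h : AffineIndependent ℝ ![A, B, C]) :
    volume ((ball A 1 ∪ ball B 1 ∪ ball C 1) ∩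
        convexHull ℝ ({A, B, C} : Set (EuclideanSpace ℝ (Fin 2)))) ≤ ENNReal.ofReal (π / 2) := by
  let b : AffineBasis (Fin 3) ℝ (EuclideanSpace ℝ (Fin 2)) :=
    ⟨![A, B, C], h, by rw [h.affineSpan_eq_top_iff_card_eq_finrank_add_one]; simp⟩
  have hb : Set.range b = {A, B, C} := by
    change Set.range ![A, B, C] = _
    rw [Matrix.range_cons, Matrix.range_cons, Matrix.range_cons, Matrix.range_empty,
      Set.union_empty, Set.singleton_union, Set.singleton_union]
  set T := convexHull ℝ ({A, B, C} : Set (EuclideanSpace ℝ (Fin 2))) with hT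
  have hint : interior T = {x | ∀ i, 0 < b.coord i x} := by
    rw [hT, ← hb, b.interior_convexHull]
  let f : EuclideanSpace ℝ (Fin 2) →L[ℝ] ℝ := (b.coord 1).linear.toContinuousLinearMap
  let g : EuclideanSpace ℝ (Fin 2) →L[ℝ] ℝ := (b.coord 2).linear.toContinuousLinearMap
  have hf : ∀ x y, f (x - y) = b.coord 1 x - b.coord 1 y := fun x y =>
    (b.coord 1).linearMap_vsub x y
  have hg : ∀ x y, g (x - y) = b.coord 2 x - b.coord 2 y := fun x y =>
    (b.coord 2).linearMap_vsub x y
  have hsum : ∀ x, b.coord 0 x + b.coord 1 x + b.coord 2 x = 1 := fun x => by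
    rw [← Fin.sum_univ_three (fun i => b.coord i x), b.sum_coord_apply_eq_one]
  have hA : ∀ i, b.coord i A = if i = 0 then 1 else 0 := fun i => b.coord_apply i 0
  have hB : ∀ i, b.coord i B = if i = 1 then 1 else 0 := fun i => b.coord_apply i 1
  have hC : ∀ i, b.coord i C = if i = 2 then 1 else 0 := fun i => b.coord_apply i 2
  have hfc : Continuous f := f.continuous
  have hgc : Continuous g := g.continuous
  have hsub : (ball A 1 ∪ ball B 1 ∪ ball C 1) ∩ T ⊆
      ((fun x => x - A) ⁻¹' (ball 0 1 ∩ {x | 0 < f x ∧ 0 < g x}) ∪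
        (fun x => B - x) ⁻¹' (ball 0 1 ∩ {x | g x < 0 ∧ 0 < f x + g x}) ∪
        (fun x => C - x) ⁻¹' (ball 0 1 ∩ {x | f x < 0 ∧ 0 < f x + g x})) ∪ frontier T := by
    rintro x ⟨hx, hxT⟩
    by_cases hxi : x ∈ interior T
    · left
      rw [hint] at hxi
      have h0 := hxi 0
      have h1 := hxi 1
      have h2 := hxi 2
      have h3 := hsum x
      rcases hx with (hx | hx) | hx
      · refine Or.inl (Or.inl ⟨by simpa [dist_eq_norm] using hx, ?_⟩)
        simp only [Set.mem_ofPred_eq, hf, hg, hA]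
        simp [h1, h2]
      · refine Or.inl (Or.inr ⟨by simpa [dist_eq_norm, norm_sub_rev] using hx, ?_⟩)
        simp only [Set.mem_ofPred_eq, hf, hg, hB]
        constructor <;> simp <;> linarith
      · refine Or.inr ⟨by simpa [dist_eq_norm, norm_sub_rev] using hx, ?_⟩
        simp only [Set.mem_ofPred_eq, hf, hg, hC]
        constructor <;> simp <;> linarith
    · exact Or.inr ⟨subset_closure hxT, hxi⟩
  refine (measure_mono hsub).trans ((measure_union_le _ _).trans ?_)
  rw [(convex_convexHull ℝ _).addHaar_frontier volume, add_zero]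
  refine le_trans ?_ (volume_ball_inter_cones_le f g)
  refine (measure_union_le _ _).trans
    (add_le_add ((measure_union_le _ _).trans (add_le_add ?_ ?_)) ?_)
  · exact ((measurePreserving_sub_right volume A).measure_preimage
      (isOpen_ball.inter ((isOpen_lt continuous_const hfc).inter
        (isOpen_lt continuous_const hgc))).measurableSet.nullMeasurableSet).le
  · exact ((Measure.measurePreserving_sub_left volume B).measure_preimage
      (isOpen_ball.inter ((isOpen_lt hgc continuous_const).inter
        (isOpen_lt continuous_const (hfc.add hgc)))).measurableSet.nullMeasurableSet).le
  · exact ((Measure.measurePreserving_sub_left volume C).measure_preimage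
      (isOpen_ball.inter ((isOpen_lt hfc continuous_const).inter
        (isOpen_lt continuous_const (hfc.add hgc)))).measurableSet.nullMeasurableSet).le

/-- If `p, q, r ≥ 4` are the squared side lengths of a triangle, `F` is sixteen times its squared
area (by Heron's formula) and its circumradius is at most `2`, i.e. `p * q * r ≤ 4 * F`, then
`48 ≤ F`. -/
theorem le_sixteen_mul_area_sq_of_circumradius_lt {p q r F : ℝ} (hp : 4 ≤ p) (hq : 4 ≤ q)
    (hr : 4 ≤ r) (hF : F = 2 * (p * q + q * r + r * p) - p ^ 2 - q ^ 2 - r ^ 2)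
    (hR : p * q * r ≤ 4 * F) : 48 ≤ F := by
  wlog hpr : p ≤ r generalizing p q r
  · exact this hr hq hp (by linarith) (by linarith) (by linarith)
  wlog hqr : q ≤ r generalizing p q r
  · exact this hp hr hq (by linarith) (by linarith) (by linarith) (by linarith)
  have hpq : 16 ≤ p * q := by nlinarith
  rcases le_total 12 r with h | h
  · nlinarith
  · have hF' : F = 4 * (p * q) - (p + q - r) ^ 2 := by rw [hF]; ring
    rcases le_total r (p + q) with h1 | h1
    · nlinarith [mul_nonneg (sub_nonneg.2 h1) (sub_nonneg.2 hpr),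
        mul_nonneg (sub_nonneg.2 hpr) (sub_nonneg.2 hqr),
        mul_nonneg (sub_nonneg.2 h1) (sub_nonneg.2 hqr)]
    · nlinarith

/-- A triangle with sides at least `2` and circumradius less than `2` has area at least `√3`. -/
theorem two_mul_sqrt_three_le_abs_det (A B C : EuclideanSpace ℝ (Fin 2))
    (h : AffineIndependent ℝ ![A, B, C])
    (hAB : 2 ≤ dist A B) (hBC : 2 ≤ dist B C) (hCA : 2 ≤ dist C A)
    (hR : (⟨![A, B, C], h⟩ : Affine.Triangle ℝ (EuclideanSpace ℝ (Fin 2))).circumradius < 2) :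
    2 * √3 ≤ |(B 0 - A 0) * (C 1 - A 1) - (B 1 - A 1) * (C 0 - A 0)| := by
  set t : Affine.Triangle ℝ (EuclideanSpace ℝ (Fin 2)) := ⟨![A, B, C], h⟩
  have hdist : ∀ x y : EuclideanSpace ℝ (Fin 2),
      dist x y ^ 2 = (x 0 - y 0) ^ 2 + (x 1 - y 1) ^ 2 := fun x y => by
    rw [EuclideanSpace.dist_eq, Real.sq_sqrt (by positivity)]
    simp [Fin.sum_univ_two, Real.dist_eq, sq_abs]
  have hOA : dist A t.circumcenter = t.circumradius := t.dist_circumcenter_eq_circumradius 0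
  have hOB : dist B t.circumcenter = t.circumradius := t.dist_circumcenter_eq_circumradius 1
  have hOC : dist C t.circumcenter = t.circumradius := t.dist_circumcenter_eq_circumradius 2
  set O := t.circumcenter
  set R := t.circumradius
  have hR0 : 0 ≤ R := t.circumradius_nonneg
  have eA := hdist A O
  have eB := hdist B O
  have eC := hdist C O
  rw [hOA] at eA
  rw [hOB] at eB
  rw [hOC] at eC
  have e1 : 2 * ((O 0 - A 0) * (B 0 - A 0) + (O 1 - A 1) * (B 1 - A 1)) = dist A B ^ 2 := by
    rw [hdist]; linear_combination eB - eA
  have e2 : 2 * ((O 0 - A 0) * (C 0 - A 0) + (O 1 - A 1) * (C 1 - A 1)) = dist C A ^ 2 := by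
    rw [hdist]; linear_combination eC - eA
  set D := (B 0 - A 0) * (C 1 - A 1) - (B 1 - A 1) * (C 0 - A 0) with hD
  have e3 : 2 * D * (O 0 - A 0) = dist A B ^ 2 * (C 1 - A 1) - dist C A ^ 2 * (B 1 - A 1) := by
    rw [← e1, ← e2]; ring
  have e4 : 2 * D * (O 1 - A 1) = dist C A ^ 2 * (B 0 - A 0) - dist A B ^ 2 * (C 0 - A 0) := by
    rw [← e1, ← e2]; ring
  have key : 4 * D ^ 2 * R ^ 2 = dist A B ^ 2 * dist B C ^ 2 * dist C A ^ 2 := by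
    have : 4 * D ^ 2 * R ^ 2 =
        (2 * D * (O 0 - A 0)) ^ 2 + (2 * D * (O 1 - A 1)) ^ 2 := by rw [eA]; ring
    rw [this, e3, e4, hdist, hdist, hdist]
    ring
  have hsq : ∀ {x : ℝ}, 2 ≤ x → 4 ≤ x ^ 2 := fun hx => by nlinarith only [hx]
  have hR4 : R ^ 2 ≤ 4 := by nlinarith only [hR, hR0]
  have h48 : 48 ≤ 4 * D ^ 2 := by
    refine le_sixteen_mul_area_sq_of_circumradius_lt (p := dist A B ^ 2) (q := dist B C ^ 2)
      (r := dist C A ^ 2) (hsq hAB) (hsq hBC) (hsq hCA) ?_ ?_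
    · rw [hdist, hdist, hdist, hD]; ring
    · rw [← key]
      have := mul_le_mul_of_nonneg_left hR4 (show 0 ≤ 4 * D ^ 2 by positivity)
      linarith
  refine abs_le_of_sq_le_sq' ?_ (abs_nonneg D) |>.2
  rw [mul_pow, Real.sq_sqrt (by norm_num), sq_abs]
  linarith

theorem sectors_area_le_density_bound
    (A B C : EuclideanSpace ℝ (Fin 2))
    (h : AffineIndependent ℝ ![A, B, C])
    (hAB : 2 ≤ dist A B) (hBC : 2 ≤ dist B C) (hCA : 2 ≤ dist C A)
    (hR : (⟨![A, B, C], h⟩ : Affine.Triangle ℝ (EuclideanSpace ℝ (Fin 2))).circumradius < 2) :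
    volume ((ball A 1 ∪ ball B 1 ∪ ball C 1) ∩
        convexHull ℝ ({A, B, C} : Set (EuclideanSpace ℝ (Fin 2)))) ≤
      ENNReal.ofReal (π / Real.sqrt 12) *
        volume (convexHull ℝ ({A, B, C} : Set (EuclideanSpace ℝ (Fin 2)))) := by
  have harea : ENNReal.ofReal √3 ≤
      volume (convexHull ℝ ({A, B, C} : Set (EuclideanSpace ℝ (Fin 2)))) := by
    have := (ENNReal.ofReal_le_ofReal (two_mul_sqrt_three_le_abs_det A B C h hAB hBC hCA hR)).trans
      (ofReal_abs_det_le_two_mul_volume_convexHull A B C)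
    rw [ENNReal.ofReal_mul two_pos.le, ENNReal.ofReal_ofNat] at this
    exact (ENNReal.mul_le_mul_iff_right (by simp) (by simp)).1 this
  have hpi : π / 2 = π / √12 * √3 := by
    have h12 : √12 = 2 * √3 := by
      rw [show (12 : ℝ) = 2 ^ 2 * 3 by norm_num, Real.sqrt_mul (by positivity),
        Real.sqrt_sq two_pos.le]
    have h3 : √3 ≠ 0 := by positivity
    rw [h12]
    field_simp
  calc _ ≤ ENNReal.ofReal (π / 2) := volume_balls_inter_convexHull_le A B C h
    _ = ENNReal.ofReal (π / √12) * ENNReal.ofReal √3 := by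
      rw [hpi, ENNReal.ofReal_mul (by positivity)]
    _ ≤ _ := by gcongr
end

section
/- (Thue's theorem.) Let S be any set of points in the Euclidean plane such that any two distinct points of S are at distance at least 2 (so that the open unit disks centered at the points of S are pairwise disjoint). Then the upper packing density of S is at most π/√12: limsup_{R→∞} vol((⋃_{p∈S} B(p,1)) ∩ B(0,R)) / (πR²) ≤ π/√12, where B(x,r) denotes the open ball of radius r around x and vol denotes 2-dimensional Lebesgue measure. -/
open Real MeasureTheory Metric Filter

lemma lintegral_ofReal_Ioo_zero (c : ℝ) (hc : 0 ≤ c) :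
    ∫⁻ r in Set.Ioo 0 c, ENNReal.ofReal r = ENNReal.ofReal (c ^ 2 / 2) := by
  rw [← ofReal_integral_eq_lintegral_ofReal, ← integral_Ioc_eq_integral_Ioo,
    ← intervalIntegral.integral_of_le hc, integral_id]
  · simp
  · exact (continuous_id.integrableOn_Icc (a := 0) (b := c)).mono_set Set.Ioo_subset_Icc_self
  · exact (ae_restrict_mem measurableSet_Ioo).mono fun r hr => hr.1.le

lemma volume_eq_integral_of_polar {A : Set ℂ} (hA : MeasurableSet A) {α : ℝ} (hα : 0 ≤ α)
    (hαπ : α ≤ π) {f : ℝ → ℝ} (hf : ContinuousOn f (Set.Icc (-α) α))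
    (hf0 : ∀ θ ∈ Set.Ioo (-α) α, 0 ≤ f θ)
    (h : ∀ r > 0, ∀ θ ∈ Set.Ioo (-π) π,
      (Complex.polarCoord.symm (r, θ) ∈ A ↔ θ ∈ Set.Ioo (-α) α ∧ r < f θ)) :
    volume A = ENNReal.ofReal (∫ θ in -α..α, f θ ^ 2 / 2) := by
  have hsub : Set.Ioo (-α) α ⊆ Set.Ioo (-π) π := Set.Ioo_subset_Ioo (by linarith) hαπ
  have hmeas : Measurable fun p : ℝ × ℝ =>
      ENNReal.ofReal p.1 • A.indicator (1 : ℂ → ENNReal) (Complex.polarCoord.symm p) := by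
    have hs : Measurable fun p : ℝ × ℝ => Complex.polarCoord.symm p := by
      simp only [Complex.polarCoord_symm_apply]
      fun_prop
    exact (ENNReal.measurable_ofReal.comp measurable_fst).smul
      ((measurable_one.indicator hA).comp hs)
  rw [← lintegral_indicator_one hA, ← Complex.lintegral_comp_polarCoord_symm, polarCoord_target,
    Measure.volume_eq_prod, setLIntegral_prod_symm _ hmeas.aemeasurable]
  have inner : ∀ θ ∈ Set.Ioo (-π) π,
      ∫⁻ r in Set.Ioi (0 : ℝ), ENNReal.ofReal r •
        A.indicator (1 : ℂ → ENNReal) (Complex.polarCoord.symm (r, θ)) =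
      (Set.Ioo (-α) α).indicator (fun θ => ENNReal.ofReal (f θ ^ 2 / 2)) θ := by
    intro θ hθ
    by_cases hθα : θ ∈ Set.Ioo (-α) α
    · rw [Set.indicator_of_mem hθα, ← lintegral_ofReal_Ioo_zero _ (hf0 θ hθα),
        ← Set.Ioi_inter_Iio, Set.inter_comm, ← setLIntegral_indicator measurableSet_Iio]
      refine setLIntegral_congr_fun measurableSet_Ioi fun r hr => ?_
      by_cases hr' : r < f θ
      · simp [-Complex.polarCoord_symm_apply, Set.indicator, h r hr θ hθ, hr', hθα.1, hθα.2]
      · simp [-Complex.polarCoord_symm_apply, Set.indicator, h r hr θ hθ, hr']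
    · rw [Set.indicator_of_notMem hθα]
      refine (setLIntegral_congr_fun measurableSet_Ioi fun r hr => ?_).trans lintegral_zero
      simp only [Set.indicator, h r hr θ hθ, hθα]
      simp
  rw [setLIntegral_congr_fun measurableSet_Ioo inner, setLIntegral_indicator measurableSet_Ioo,
    Set.inter_eq_left.2 hsub, intervalIntegral.integral_of_le (by linarith),
    integral_Ioc_eq_integral_Ioo, ofReal_integral_eq_lintegral_ofReal]
  · exact ((hf.pow 2).div_const 2).integrableOn_Icc.mono_set Set.Ioo_subset_Icc_self
  · exact ae_of_all _ fun θ => by positivity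

lemma sin_two_mul_ge {α : ℝ} (h0 : 0 ≤ α) (h : α ≤ π / 6) :
    3 * √3 / π * α ≤ sin (2 * α) := by
  have hπ := pi_pos
  have hc := strictConcaveOn_sin_Icc.concaveOn.2
    (show (0 : ℝ) ∈ Set.Icc 0 π from ⟨le_rfl, hπ.le⟩)
    (show π / 3 ∈ Set.Icc 0 π from ⟨by positivity, by linarith⟩)
    (show 0 ≤ 1 - 6 * α / π by rw [sub_nonneg, div_le_one hπ]; linarith)
    (show 0 ≤ 6 * α / π by positivity) (by ring)
  have e : 6 * α / π * (π / 3) = 2 * α := by field_simp; ring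
  simp only [smul_eq_mul, mul_zero, sin_zero, zero_add, sin_pi_div_three, e] at hc
  refine le_trans (le_of_eq ?_) hc
  ring

lemma integral_inv_cos_sq {α : ℝ} (h0 : 0 ≤ α) (h : α < π / 2) (c : ℝ) :
    ∫ θ in -α..α, (c / cos θ) ^ 2 / 2 = c ^ 2 * tan α := by
  have hcos : ∀ θ ∈ Set.uIcc (-α) α, cos θ ≠ 0 := by
    intro θ hθ
    rw [Set.uIcc_of_le (by linarith)] at hθ
    exact (cos_pos_of_mem_Ioo ⟨by linarith [hθ.1], by linarith [hθ.2]⟩).ne'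
  rw [intervalIntegral.integral_eq_sub_of_hasDerivAt (f := fun θ => c ^ 2 / 2 * tan θ)]
  · rw [tan_neg]; ring
  · intro θ hθ
    exact ((hasDerivAt_tan (hcos θ hθ)).const_mul (c ^ 2 / 2)).congr_deriv (by ring)
  · refine ContinuousOn.intervalIntegrable ?_
    exact ((continuousOn_const.div continuous_cos.continuousOn hcos).pow 2).div_const 2

lemma volume_sector_le {r d : ℝ} (hr : 0 < r) (hd : √3 * r ≤ d) :
    ENNReal.ofReal (3 * √3 / (2 * π)) *
        volume {z : ℂ | ‖z‖ < r ∧ ‖z‖ * d < 2 * r * z.re} ≤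
      volume {z : ℂ | ‖z‖ < r ∧ ‖z‖ * d < 2 * r * z.re ∧ 2 * z.re < d} := by
  have hd0 : 0 < d := lt_of_lt_of_le (by positivity) hd
  have hπ := pi_pos
  rcases le_or_gt (2 * r) d with hdr | hdr
  · have : {z : ℂ | ‖z‖ < r ∧ ‖z‖ * d < 2 * r * z.re} = ∅ := by
      refine Set.eq_empty_of_forall_notMem fun z ⟨_, hz⟩ => hz.not_ge ?_
      nlinarith [Complex.re_le_norm z, norm_nonneg z]
    simp [this]
  set α := arccos (d / (2 * r)) with hα
  have hq0 : 0 < d / (2 * r) := by positivity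
  have hq1 : d / (2 * r) < 1 := (div_lt_one (by positivity)).2 hdr
  have hcosα : cos α = d / (2 * r) := cos_arccos (by linarith) hq1.le
  have hα0 : 0 ≤ α := arccos_nonneg _
  have hα6 : α ≤ π / 6 := by
    rw [← arccos_cos (x := π / 6) (by positivity) (by linarith), cos_pi_div_six]
    refine arccos_le_arccos ?_
    rw [div_le_div_iff₀ (by positivity) (by positivity)]
    linarith
  have hcos : ∀ θ ∈ Set.Ioo (-π) π, (d < 2 * r * cos θ ↔ θ ∈ Set.Ioo (-α) α) := by
    intro θ hθ
    rw [← div_lt_iff₀' (by positivity), ← hcosα, ← cos_abs θ, Set.mem_Ioo, ← abs_lt]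
    exact strictAntiOn_cos.lt_iff_gt ⟨hα0, by linarith⟩
      ⟨abs_nonneg _, (abs_lt.2 hθ).le⟩
  have hcos_pos : ∀ θ ∈ Set.Icc (-α) α, 0 < cos θ := fun θ hθ =>
    cos_pos_of_mem_Ioo ⟨by linarith [hθ.1], by linarith [hθ.2]⟩
  have hnorm : ∀ t > 0, ∀ θ, ‖Complex.polarCoord.symm (t, θ)‖ = t := fun t ht θ => by
    rw [Complex.norm_polarCoord_symm, abs_of_pos ht]
  have hre : ∀ t θ, (Complex.polarCoord.symm (t, θ)).re = t * cos θ := fun t θ => by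
    simp [Complex.cos_ofReal_re]
  have hcone : ∀ t > 0, ∀ θ ∈ Set.Ioo (-π) π,
      (t * d < 2 * r * (t * cos θ) ↔ θ ∈ Set.Ioo (-α) α) := fun t ht θ hθ => by
    rw [← hcos θ hθ, show 2 * r * (t * cos θ) = t * (2 * r * cos θ) by ring,
      mul_lt_mul_iff_right₀ ht]
  rw [volume_eq_integral_of_polar (α := α) (f := fun _ => r) _ hα0 (by linarith)
      continuousOn_const (fun _ _ => hr.le),
    volume_eq_integral_of_polar (α := α) (f := fun θ => (d / 2) / cos θ) _ hα0 (by linarith)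
      (continuousOn_const.div continuous_cos.continuousOn fun θ hθ => (hcos_pos θ hθ).ne')
      (fun θ hθ => (div_pos (by positivity) (hcos_pos θ (Set.Ioo_subset_Icc_self hθ))).le),
    ← ENNReal.ofReal_mul (by positivity), integral_inv_cos_sq hα0 (by linarith)]
  · refine ENNReal.ofReal_le_ofReal ?_
    have h1 : (d / 2) ^ 2 * tan α = r ^ 2 / 2 * sin (2 * α) := by
      rw [show d / 2 = r * cos α by rw [hcosα]; field_simp, tan_eq_sin_div_cos, sin_two_mul]
      field_simp [(hcos_pos α ⟨by linarith, le_rfl⟩).ne']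
    rw [h1, intervalIntegral.integral_const]
    calc _ = r ^ 2 / 2 * (3 * √3 / π * α) := by simp only [smul_eq_mul]; field_simp; ring
      _ ≤ _ := by gcongr; exact sin_two_mul_ge hα0 hα6
  · intro t ht θ hθ
    simp only [Set.mem_ofPred_eq, hnorm t ht, hre, hcone t ht θ hθ]
    constructor
    · rintro ⟨-, h2, h3⟩
      refine ⟨h2, ?_⟩
      rw [lt_div_iff₀ (hcos_pos θ (Set.Ioo_subset_Icc_self h2))]
      linarith
    · rintro ⟨h2, h3⟩
      have hc := hcos_pos θ (Set.Ioo_subset_Icc_self h2)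
      rw [lt_div_iff₀ hc] at h3
      refine ⟨?_, h2, by linarith⟩
      have := (hcos θ hθ).2 h2
      by_contra! hrt
      nlinarith
  · refine ((isOpen_lt ?_ ?_).and ((isOpen_lt ?_ ?_).and (isOpen_lt ?_ ?_))).measurableSet <;>
      fun_prop
  · intro t ht θ hθ
    simp only [Set.mem_ofPred_eq, hnorm t ht, hre, hcone t ht θ hθ]
    exact and_comm
  · refine ((isOpen_lt ?_ ?_).and (isOpen_lt ?_ ?_)).measurableSet <;> fun_prop

lemma exists_linearIsometryEquiv_complex (v : EuclideanSpace ℝ (Fin 2)) :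
    ∃ Φ : ℂ ≃ₗᵢ[ℝ] EuclideanSpace ℝ (Fin 2), Φ (‖v‖ : ℂ) = v := by
  set e := Complex.orthonormalBasisOneI.repr
  refine ⟨(rotation (Circle.exp (Complex.arg (e.symm v)))).trans e, ?_⟩
  rw [LinearIsometryEquiv.trans_apply, rotation_apply, Circle.coe_exp,
    ← e.symm.norm_map v, mul_comm, Complex.norm_mul_exp_arg_mul_I, e.apply_symm_apply]

/-- The open circular sector of the disk of radius `r` about the origin which is cut out by the
chord along which this disk meets the disk of radius `r` about `v`. -/
def chordSector (r : ℝ) (v : EuclideanSpace ℝ (Fin 2)) : Set (EuclideanSpace ℝ (Fin 2)) :=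
  {x | ‖x‖ < r ∧ ‖x‖ * ‖v‖ ^ 2 < 2 * r * inner ℝ x v}

lemma isOpen_chordSector (r : ℝ) (v : EuclideanSpace ℝ (Fin 2)) : IsOpen (chordSector r v) := by
  refine (isOpen_lt ?_ ?_).and (isOpen_lt ?_ ?_) <;> fun_prop

lemma volume_chordSector_le {r : ℝ} {v : EuclideanSpace ℝ (Fin 2)} (hr : 0 < r)
    (hv : √3 * r ≤ ‖v‖) :
    ENNReal.ofReal (3 * √3 / (2 * π)) * volume (chordSector r v) ≤
      volume (chordSector r v ∩ {x | 2 * inner ℝ x v < ‖v‖ ^ 2}) := by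
  obtain ⟨Φ, hΦ⟩ := exists_linearIsometryEquiv_complex v
  have hv0 : 0 < ‖v‖ := lt_of_lt_of_le (by positivity) hv
  have hinner : ∀ z : ℂ, inner ℝ (Φ z) v = z.re * ‖v‖ := fun z => by
    conv_lhs => rw [← hΦ, Φ.inner_map_map, Complex.inner]
    simp [mul_comm]
  have hcone : ∀ z : ℂ, ‖z‖ * ‖v‖ ^ 2 < 2 * r * (z.re * ‖v‖) ↔ ‖z‖ * ‖v‖ < 2 * r * z.re :=
    fun z => by
      rw [← mul_lt_mul_iff_left₀ hv0 (b := ‖z‖ * ‖v‖)]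
      ring_nf
  have hhalf : ∀ z : ℂ, 2 * (z.re * ‖v‖) < ‖v‖ ^ 2 ↔ 2 * z.re < ‖v‖ := fun z => by
    rw [← mul_lt_mul_iff_left₀ hv0 (b := 2 * z.re)]
    ring_nf
  have hmeas : MeasurableSet {x : EuclideanSpace ℝ (Fin 2) | 2 * inner ℝ x v < ‖v‖ ^ 2} :=
    measurableSet_lt (by fun_prop) (by fun_prop)
  have hm := (isOpen_chordSector r v).measurableSet
  rw [← Φ.measurePreserving.measure_preimage hm.nullMeasurableSet,
    ← Φ.measurePreserving.measure_preimage (hm.inter hmeas).nullMeasurableSet]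
  convert volume_sector_le hr hv using 3
  · ext z
    simp [chordSector, hinner, hcone]
  · ext z
    simp [chordSector, hinner, hcone, hhalf, and_assoc]

/-- Three points at pairwise distance at least `2` have circumradius at least `2 / √3`. -/
lemma not_three_close {F : Type*} [NormedAddCommGroup F] [InnerProductSpace ℝ F] {u v w : F}
    (huv : 2 ≤ ‖u - v‖) (huw : 2 ≤ ‖u - w‖) (hvw : 2 ≤ ‖v - w‖) (hu : ‖u‖ ≤ 2 / √3)
    (hv : ‖v‖ < 2 / √3) (hw : ‖w‖ < 2 / √3) : False := by
  have hr : (2 / √3) ^ 2 = 4 / 3 := by rw [div_pow, sq_sqrt (by norm_num)]; norm_num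
  have h1 : ‖u‖ ^ 2 ≤ 4 / 3 := hr ▸ pow_le_pow_left₀ (norm_nonneg _) hu 2
  have h2 : ‖v‖ ^ 2 < 4 / 3 := hr ▸ pow_lt_pow_left₀ hv (norm_nonneg _) two_ne_zero
  have h3 : ‖w‖ ^ 2 < 4 / 3 := hr ▸ pow_lt_pow_left₀ hw (norm_nonneg _) two_ne_zero
  have h4 := pow_le_pow_left₀ zero_le_two huv 2
  have h5 := pow_le_pow_left₀ zero_le_two huw 2
  have h6 := pow_le_pow_left₀ zero_le_two hvw 2
  have h7 := sq_nonneg ‖u + v + w‖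
  rw [norm_sub_sq_real] at h4 h5 h6
  rw [norm_add_sq_real, norm_add_sq_real, inner_add_left] at h7
  linarith

lemma norm_smul_sub_lt {r : ℝ} {x v : EuclideanSpace ℝ (Fin 2)} (hx0 : x ≠ 0)
    (hx : x ∈ chordSector r v) : ‖(r / ‖x‖) • x - v‖ < r := by
  have hx' : 0 < ‖x‖ := norm_pos_iff.2 hx0
  have hr : 0 < r := hx'.trans hx.1
  refine lt_of_pow_lt_pow_left₀ 2 hr.le ?_
  rw [norm_sub_sq_real, norm_smul, norm_of_nonneg (by positivity), inner_smul_left,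
    div_mul_cancel₀ _ hx'.ne']
  have : ‖v‖ ^ 2 < 2 * (r / ‖x‖ * inner ℝ x v) := by
    rw [show 2 * (r / ‖x‖ * inner ℝ x v) = 2 * r * inner ℝ x v / ‖x‖ by ring, lt_div_iff₀ hx']
    linarith [hx.2]
  simp only [conj_trivial]
  linarith

lemma disjoint_chordSector {v w : EuclideanSpace ℝ (Fin 2)} (hv : 2 ≤ ‖v‖) (hw : 2 ≤ ‖w‖)
    (hvw : 2 ≤ ‖v - w‖) : Disjoint (chordSector (2 / √3) v) (chordSector (2 / √3) w) := by
  refine Set.disjoint_left.2 fun x hxv hxw => ?_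
  have hx0 : x ≠ 0 := by
    rintro rfl
    simpa using hxv.2
  have hx' : 0 < ‖x‖ := norm_pos_iff.2 hx0
  set y := (2 / √3 / ‖x‖) • x with hy
  have hyn : ‖y‖ = 2 / √3 := by
    rw [hy, norm_smul, norm_of_nonneg (by positivity), div_mul_cancel₀ _ hx'.ne']
  refine not_three_close (u := y) (v := y - v) (w := y - w) ?_ ?_ ?_ hyn.le
    (norm_smul_sub_lt hx0 hxv) (norm_smul_sub_lt hx0 hxw)
  · simpa using hv
  · simpa using hw
  · rwa [sub_sub_sub_cancel_left, norm_sub_rev]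

/-- The Voronoi cell of the origin with respect to the nonzero points of `V`, truncated by the
disk of radius `2 / √3`. -/
def truncatedCell (V : Set (EuclideanSpace ℝ (Fin 2))) : Set (EuclideanSpace ℝ (Fin 2)) :=
  {x | ‖x‖ < 2 / √3 ∧ ∀ v ∈ V, 2 * inner ℝ x v < ‖v‖ ^ 2}

lemma measurableSet_truncatedCell {V : Set (EuclideanSpace ℝ (Fin 2))} (hV : V.Countable) :
    MeasurableSet (truncatedCell V) := by
  have : truncatedCell V =
      ball 0 (2 / √3) ∩ ⋂ v ∈ V, {x | 2 * inner ℝ x v < ‖v‖ ^ 2} := by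
    ext x
    simp [truncatedCell]
  rw [this]
  refine measurableSet_ball.inter (MeasurableSet.biInter hV fun v _ => ?_)
  refine (isOpen_lt ?_ ?_).measurableSet <;> fun_prop

lemma volume_truncatedCell_ge {V : Set (EuclideanSpace ℝ (Fin 2))} (hVc : V.Countable)
    (hV : ∀ v ∈ V, 2 ≤ ‖v‖) (hpack : ∀ v ∈ V, ∀ w ∈ V, v ≠ w → 2 ≤ ‖v - w‖) :
    ENNReal.ofReal √12 ≤ volume (truncatedCell V) := by
  have hπ := pi_pos
  set r : ℝ := 2 / √3 with hr
  set s := ENNReal.ofReal (3 * √3 / (2 * π)) with hs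
  have h3 : √3 ^ 2 = 3 := sq_sqrt (by norm_num)
  have hr0 : 0 < r := by positivity
  have hs1 : s ≤ 1 := by
    rw [hs, ENNReal.ofReal_le_one, div_le_one (by positivity)]
    nlinarith [pi_gt_three, sqrt_nonneg 3]
  have h12 : √12 = 2 * √3 := by
    rw [show (12 : ℝ) = 2 ^ 2 * 3 by norm_num, sqrt_mul (by norm_num), sqrt_sq (by norm_num)]
  set C : Set (EuclideanSpace ℝ (Fin 2)) := ⋃ v ∈ V, chordSector r v with hC
  have hdisj : V.PairwiseDisjoint (chordSector r) := fun v hv w hw hvw =>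
    disjoint_chordSector (hV v hv) (hV w hw) (hpack v hv w hw hvw)
  have hmC : MeasurableSet C :=
    MeasurableSet.biUnion hVc fun v _ => (isOpen_chordSector r v).measurableSet
  have hCin : s * volume C ≤ volume (truncatedCell V ∩ C) := by
    rw [hC, Set.inter_iUnion₂, measure_biUnion hVc hdisj
        fun v _ => (isOpen_chordSector r v).measurableSet,
      measure_biUnion hVc (hdisj.mono fun v => Set.inter_subset_right)
        fun v _ => (measurableSet_truncatedCell hVc).inter (isOpen_chordSector r v).measurableSet,
      ← ENNReal.tsum_mul_left]
    refine ENNReal.tsum_le_tsum fun v => ?_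
    refine (volume_chordSector_le hr0 ?_).trans (measure_mono ?_)
    · rw [hr, mul_div_cancel₀ _ (by positivity)]
      exact hV v v.2
    · rintro x ⟨hx, hxv⟩
      refine ⟨⟨hx.1, fun w hw => ?_⟩, hx⟩
      by_cases hvw : w = v
      · exact hvw ▸ hxv
      · by_contra! hcon
        have hw0 : 0 < ‖w‖ := by linarith [hV w hw]
        refine Set.disjoint_left.1 (hdisj hw v.2 hvw) ⟨hx.1, ?_⟩ hx
        have : ‖x‖ * ‖w‖ ^ 2 < r * ‖w‖ ^ 2 := by gcongr; exact hx.1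
        nlinarith
  have hCout : ball 0 r \ C ⊆ truncatedCell V \ C := by
    rintro x ⟨hx, hxC⟩
    rw [mem_ball_zero_iff] at hx
    refine ⟨⟨hx, fun w hw => ?_⟩, hxC⟩
    by_contra! hcon
    have hw0 : 0 < ‖w‖ := by linarith [hV w hw]
    refine hxC (Set.mem_iUnion₂.2 ⟨w, hw, hx, ?_⟩)
    have : ‖x‖ * ‖w‖ ^ 2 < r * ‖w‖ ^ 2 := by gcongr
    nlinarith
  calc ENNReal.ofReal √12 = s * volume (ball (0 : EuclideanSpace ℝ (Fin 2)) r) := by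
        rw [EuclideanSpace.volume_ball_fin_two, ← ENNReal.ofReal_pow hr0.le,
          ← ENNReal.ofReal_mul (by positivity), ← ENNReal.ofReal_mul (by positivity), h12, hr]
        congr 1
        field_simp
        linarith
    _ ≤ s * (volume C + volume (ball 0 r \ C)) := by
        gcongr
        exact (measure_mono (by rw [Set.union_sdiff_self]; exact Set.subset_union_right)).trans
          (measure_union_le C (ball 0 r \ C))
    _ ≤ volume (truncatedCell V ∩ C) + volume (truncatedCell V \ C) := by
        rw [mul_add]
        exact add_le_add hCin ((mul_le_of_le_one_left' hs1).trans (measure_mono hCout))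
    _ = volume (truncatedCell V) := measure_inter_add_sdiff _ hmC

lemma sub_mem_truncatedCell_iff {S : Set (EuclideanSpace ℝ (Fin 2))}
    {p x : EuclideanSpace ℝ (Fin 2)} :
    x - p ∈ truncatedCell ((· - p) '' (S \ {p})) ↔
      dist x p < 2 / √3 ∧ ∀ q ∈ S, q ≠ p → dist x p < dist x q := by
  have key : ∀ q, 2 * inner ℝ (x - p) (q - p) < ‖q - p‖ ^ 2 ↔ dist x p < dist x q := fun q => by
    rw [dist_eq_norm, dist_eq_norm, ← sub_sub_sub_cancel_right x q p,
      ← pow_lt_pow_iff_left₀ (norm_nonneg _) (norm_nonneg _) two_ne_zero,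
      norm_sub_sq_real (x - p) (q - p)]
    constructor <;> intro h <;> linarith
  simp only [truncatedCell, Set.mem_ofPred_eq, Set.forall_mem_image, key]
  simp [dist_eq_norm x p]

lemma volume_packing_le {S : Set (EuclideanSpace ℝ (Fin 2))}
    (hpack : ∀ p ∈ S, ∀ q ∈ S, p ≠ q → 2 ≤ dist p q) {R : ℝ} (hR : 0 ≤ R) :
    volume ((⋃ p ∈ S, ball p 1) ∩ ball (0 : EuclideanSpace ℝ (Fin 2)) R) ≤
      ENNReal.ofReal (π / √12) * ENNReal.ofReal (π * (R + 3) ^ 2) := by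
  have hcount : S.Countable := by
    refine Set.PairwiseDisjoint.countable_of_isOpen (s := fun p => ball p 1)
      (fun p hp q hq hpq => ball_disjoint_ball ?_) (fun _ _ => isOpen_ball)
      (fun p _ => nonempty_ball.2 one_pos)
    linarith [hpack p hp q hq hpq]
  set S' := S ∩ ball 0 (R + 1) with hS'
  have hcount' : S'.Countable := hcount.mono Set.inter_subset_left
  let T : EuclideanSpace ℝ (Fin 2) → Set (EuclideanSpace ℝ (Fin 2)) := fun p =>
    (fun x => x - p) ⁻¹' truncatedCell ((· - p) '' (S \ {p}))
  have hTmem : ∀ p x, x ∈ T p ↔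
      dist x p < 2 / √3 ∧ ∀ q ∈ S, q ≠ p → dist x p < dist x q := fun p x =>
    sub_mem_truncatedCell_iff
  have hTmeas : ∀ p, MeasurableSet (T p) := fun p =>
    (measurable_sub_const p) (measurableSet_truncatedCell ((hcount.mono Set.sdiff_subset).image _))
  have hTdisj : S'.PairwiseDisjoint T := by
    refine fun p hp q hq hpq => Set.disjoint_left.2 fun x hxp hxq => ?_
    exact lt_asymm (((hTmem p x).1 hxp).2 q hq.1 hpq.symm) (((hTmem q x).1 hxq).2 p hp.1 hpq)
  have hTvol : ∀ p ∈ S', ENNReal.ofReal √12 ≤ volume (T p) := by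
    intro p hp
    rw [(measurePreserving_sub_right volume p).measure_preimage
      (measurableSet_truncatedCell
        ((hcount.mono Set.sdiff_subset).image _)).nullMeasurableSet]
    refine volume_truncatedCell_ge ((hcount.mono Set.sdiff_subset).image _) ?_ ?_
    · rintro _ ⟨q, ⟨hq, hqp⟩, rfl⟩
      exact dist_eq_norm q p ▸ hpack q hq p hp.1 hqp
    · rintro _ ⟨q, ⟨hq, -⟩, rfl⟩ _ ⟨q', ⟨hq', -⟩, rfl⟩ hne
      rw [sub_sub_sub_cancel_right, ← dist_eq_norm]
      exact hpack q hq q' hq' fun h => hne (by rw [h])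
  have hsub : (⋃ p ∈ S, ball p 1) ∩ ball (0 : EuclideanSpace ℝ (Fin 2)) R ⊆
      ⋃ p ∈ S', ball p 1 := by
    rintro x ⟨hx, hxR⟩
    obtain ⟨p, hp, hxp⟩ := Set.mem_iUnion₂.1 hx
    refine Set.mem_iUnion₂.2 ⟨p, ⟨hp, ?_⟩, hxp⟩
    rw [mem_ball] at *
    linarith [dist_triangle_left p 0 x]
  have hTsub : ⋃ p ∈ S', T p ⊆ ball 0 (R + 3) := by
    refine Set.iUnion₂_subset fun p hp x hx => ?_
    have h1 := ((hTmem p x).1 hx).1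
    have h2 : 2 / √3 ≤ 2 := div_le_self zero_le_two (one_le_sqrt.2 (by norm_num))
    have h3 := mem_ball.1 hp.2
    rw [mem_ball]
    linarith [dist_triangle x p 0]
  calc _ ≤ volume (⋃ p ∈ S', ball p 1) := measure_mono hsub
    _ ≤ ∑' p : S', volume (ball (p : EuclideanSpace ℝ (Fin 2)) 1) :=
        measure_biUnion_le volume hcount' _
    _ ≤ ∑' p : S', ENNReal.ofReal (π / √12) * volume (T p) := by
        refine ENNReal.tsum_le_tsum fun p => ?_
        refine le_trans (le_of_eq ?_) (mul_le_mul_right (hTvol p p.2) _)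
        rw [← ENNReal.ofReal_mul (by positivity), div_mul_cancel₀ _ (by positivity)]
        simp
    _ = ENNReal.ofReal (π / √12) * volume (⋃ p ∈ S', T p) := by
        rw [ENNReal.tsum_mul_left, measure_biUnion hcount' hTdisj fun p _ => hTmeas p]
    _ ≤ ENNReal.ofReal (π / √12) * volume (ball (0 : EuclideanSpace ℝ (Fin 2)) (R + 3)) := by
        gcongr
    _ = _ := by
        rw [EuclideanSpace.volume_ball_fin_two, ← ENNReal.ofReal_pow (by positivity),
          ← ENNReal.ofReal_mul (by positivity), mul_comm π]

theorem thue_theorem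
    (S : Set (EuclideanSpace ℝ (Fin 2)))
    (hpack : ∀ p ∈ S, ∀ q ∈ S, p ≠ q → 2 ≤ dist p q) :
    limsup (fun R : ℝ =>
        volume ((⋃ p ∈ S, ball p 1) ∩ ball (0 : EuclideanSpace ℝ (Fin 2)) R) /
          ENNReal.ofReal (π * R ^ 2)) atTop ≤
      ENNReal.ofReal (π / Real.sqrt 12) := by
  have hlim : Tendsto (fun R : ℝ => ENNReal.ofReal (π / √12 * (1 + 3 / R) ^ 2)) atTop
      (nhds (ENNReal.ofReal (π / √12))) := by
    refine ENNReal.tendsto_ofReal ?_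
    have h : Tendsto (fun R : ℝ => 3 / R) atTop (nhds 0) := tendsto_const_nhds.div_atTop tendsto_id
    simpa using ((h.const_add 1).pow 2).const_mul (π / √12)
  rw [← hlim.limsup_eq]
  refine limsup_le_limsup ?_
  filter_upwards [eventually_gt_atTop 0] with R hR
  refine ENNReal.div_le_of_le_mul ((volume_packing_le hpack hR.le).trans (le_of_eq ?_))
  rw [← ENNReal.ofReal_mul (by positivity), ← ENNReal.ofReal_mul (by positivity)]
  congr 1
  field_simp
end

section
/- The hexagonal circle packing attains density π/√12: let S = {m·(2,0) + n·(1,√3) : m, n ∈ ℤ} ⊆ ℝ². Then any two distinct points of S are at distance at least 2, and the packing density limit exists and equals π/√12: lim_{R→∞} vol((⋃_{p∈S} B(p,1)) ∩ B(0,R)) / (πR²) = π/√12, where B(x,r) denotes the open ball of radius r around x and vol denotes 2-dimensional Lebesgue measure. -/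
open Real MeasureTheory Metric Filter
open scoped Pointwise

/-- The squared norm on the hexagonal lattice is a binary quadratic form. -/
theorem norm_sq_hexagonal_lattice (m n : ℤ) :
    ‖m • (!₂[2, 0] : EuclideanSpace ℝ (Fin 2)) + n • !₂[1, √3]‖ ^ 2
      = 4 * ((m ^ 2 + m * n + n ^ 2 : ℤ) : ℝ) := by
  have h : √3 ^ 2 = (3 : ℝ) := Real.sq_sqrt (by norm_num)
  rw [EuclideanSpace.real_norm_sq_eq]
  simp
  linear_combination (n : ℝ) ^ 2 * h

section Translates

variable {E : Type*} [NormedAddCommGroup E] [MeasurableSpace E]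
    {μ : Measure E} [μ.IsAddLeftInvariant]

/-- The disjoint translates of `A` by the points of `S` in `ball 0 R` stay in `ball 0 (R + D)`. -/
theorem encard_mul_measure_le [BorelSpace E] {S A : Set E} (hS : S.Countable) (hA : MeasurableSet A)
    (hd : S.PairwiseDisjoint (fun p => p +ᵥ A)) {D : ℝ} (hD : ∀ x ∈ A, ‖x‖ ≤ D) (R : ℝ) :
    ((S ∩ ball 0 R).encard : ENNReal) * μ A ≤ μ ((⋃ p ∈ S, p +ᵥ A) ∩ ball 0 (R + D)) := by
  have hc : (S ∩ ball 0 R).Countable := hS.mono Set.inter_subset_left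
  calc _ = ∑' p : ↥(S ∩ ball 0 R), μ ((p : E) +ᵥ A) := by
        simp [measure_vadd]
    _ = μ (⋃ p ∈ S ∩ ball 0 R, p +ᵥ A) :=
        (measure_biUnion hc (hd.subset Set.inter_subset_left) fun p _ => hA.const_vadd p).symm
    _ ≤ _ := by
        gcongr
        refine Set.iUnion₂_subset fun p hp => ?_
        rintro _ ⟨x, hx, rfl⟩
        refine ⟨Set.mem_biUnion hp.1 ⟨x, hx, rfl⟩, ?_⟩
        have := mem_ball_zero_iff.1 hp.2
        rw [mem_ball_zero_iff]
        exact (norm_add_le p x).trans_lt (by linarith [hD x hx])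

/-- Only translates of `A` by points of `S` in `ball 0 (R + D)` meet `ball 0 R`. -/
theorem measure_le_encard_mul {S A : Set E} (hS : S.Countable)
    {D : ℝ} (hD : ∀ x ∈ A, ‖x‖ ≤ D) (R : ℝ) :
    μ ((⋃ p ∈ S, p +ᵥ A) ∩ ball 0 R) ≤ ((S ∩ ball 0 (R + D)).encard : ENNReal) * μ A := by
  have hc : (S ∩ ball 0 (R + D)).Countable := hS.mono Set.inter_subset_left
  calc _ ≤ μ (⋃ p ∈ S ∩ ball 0 (R + D), p +ᵥ A) := by
        gcongr
        rintro y ⟨hy, hyR⟩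
        simp only [Set.mem_iUnion₂] at hy
        obtain ⟨p, hp, x, hx, rfl⟩ := hy
        refine Set.mem_biUnion ⟨hp, ?_⟩ ⟨x, hx, rfl⟩
        rw [mem_ball_zero_iff] at hyR ⊢
        have h : ‖p + x - x‖ ≤ ‖p + x‖ + ‖x‖ := norm_sub_le _ _
        rw [add_sub_cancel_right] at h
        exact h.trans_lt (add_lt_add_of_lt_of_le hyR (hD x hx))
    _ ≤ ∑' p : ↥(S ∩ ball 0 (R + D)), μ ((p : E) +ᵥ A) := measure_biUnion_le _ hc _
    _ = _ := by simp [measure_vadd]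

end Translates

theorem tendsto_volume_ball_add_div (c : ℝ) :
    Tendsto (fun R : ℝ =>
        volume (ball (0 : EuclideanSpace ℝ (Fin 2)) (R + c)) / ENNReal.ofReal (π * R ^ 2))
      atTop (nhds 1) := by
  have h : Tendsto (fun R : ℝ => ENNReal.ofReal ((1 + c / R) ^ 2)) atTop (nhds 1) := by
    have h1 : Tendsto (fun R : ℝ => (1 + c / R) ^ 2) atTop (nhds ((1 + 0) ^ 2)) :=
      ((tendsto_const_nhds.div_atTop tendsto_id).const_add 1).pow 2
    simpa using ENNReal.tendsto_ofReal h1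
  refine h.congr' ?_
  filter_upwards [eventually_gt_atTop 0, eventually_ge_atTop (-c)] with R hR hc
  rw [EuclideanSpace.volume_ball_fin_two, ← ENNReal.ofReal_pow (by linarith),
    ← ENNReal.ofReal_mul (by positivity), ← ENNReal.ofReal_div_of_pos (by positivity)]
  congr 1
  field_simp

/-- The density of disjoint lattice translates of a bounded set `A` is the area of `A` divided by
the area of a fundamental domain. -/
theorem tendsto_density_lattice_translates
    (b : Module.Basis (Fin 2) ℝ (EuclideanSpace ℝ (Fin 2))) {A : Set (EuclideanSpace ℝ (Fin 2))}
    (hA : MeasurableSet A) {D : ℝ} (hD : ∀ x ∈ A, ‖x‖ ≤ D)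
    (hd : (Submodule.span ℤ (Set.range b) : Set (EuclideanSpace ℝ (Fin 2))).PairwiseDisjoint
      (fun p => p +ᵥ A)) :
    Tendsto (fun R : ℝ =>
        volume ((⋃ p ∈ (Submodule.span ℤ (Set.range b) : Set (EuclideanSpace ℝ (Fin 2))), p +ᵥ A) ∩
          ball (0 : EuclideanSpace ℝ (Fin 2)) R) /
          ENNReal.ofReal (π * R ^ 2)) atTop
      (nhds (volume A / volume (ZSpan.fundamentalDomain b))) := by
  set S := (Submodule.span ℤ (Set.range b) : Set (EuclideanSpace ℝ (Fin 2)))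
  set F := ZSpan.fundamentalDomain b
  have hS : S.Countable := Set.countable_coe_iff.1
    (inferInstanceAs (Countable (Submodule.span ℤ (Set.range b))))
  obtain ⟨C, hC⟩ := (ZSpan.fundamentalDomain_isBounded b).exists_norm_le
  have hFm : MeasurableSet F := ZSpan.fundamentalDomain_measurableSet b
  have hF0 : volume F ≠ 0 := ZSpan.measure_fundamentalDomain_ne_zero b
  have hFt : volume F ≠ ⊤ := (ZSpan.fundamentalDomain_isBounded b).measure_lt_top.ne
  have hFd : S.PairwiseDisjoint (fun p => p +ᵥ F) := by
    intro p hp q hq hpq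
    refine Set.disjoint_left.2 ?_
    rintro _ ⟨x, hx, rfl⟩ ⟨y, hy, hxy⟩
    apply hpq
    have hx' := ZSpan.fract_eq_self.2 hx
    have hy' := ZSpan.fract_eq_self.2 hy
    simp only [vadd_eq_add] at hxy
    have h1 := ZSpan.fract_zSpan_add b x hp
    rw [← hxy, ZSpan.fract_zSpan_add b y hq, hx', hy'] at h1
    rw [h1] at hxy
    exact (add_right_cancel hxy).symm
  have hFu : ⋃ p ∈ S, p +ᵥ F = Set.univ := by
    refine Set.eq_univ_of_forall fun x =>
      Set.mem_biUnion (ZSpan.floor b x).2 ⟨_, ZSpan.fract_mem_fundamentalDomain b x, ?_⟩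
    simp [ZSpan.fract_apply]
  have lower (R : ℝ) :
      volume (ball (0 : EuclideanSpace ℝ (Fin 2)) (R + (-D - C))) * (volume A / volume F) ≤
      volume ((⋃ p ∈ S, p +ᵥ A) ∩ ball 0 R) := by
    have h1 := measure_le_encard_mul (μ := volume) hS hC (R + (-D - C))
    have h2 := encard_mul_measure_le (μ := volume) hS hA hd hD (R - D)
    rw [hFu, Set.univ_inter, show R + (-D - C) + C = R - D by ring] at h1
    rw [sub_add_cancel] at h2
    rw [← mul_div_assoc, mul_comm, mul_div_assoc, mul_comm]
    refine le_trans ?_ h2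
    gcongr
    exact ENNReal.div_le_of_le_mul h1
  have upper (R : ℝ) : volume ((⋃ p ∈ S, p +ᵥ A) ∩ ball 0 R) ≤
      volume (ball (0 : EuclideanSpace ℝ (Fin 2)) (R + (D + C))) * (volume A / volume F) := by
    have h1 := encard_mul_measure_le (μ := volume) hS hFm hFd hC (R + D)
    have h2 := measure_le_encard_mul (μ := volume) hS hD R
    rw [hFu, Set.univ_inter, add_assoc] at h1
    rw [← mul_div_assoc, mul_comm, mul_div_assoc, mul_comm]
    refine h2.trans ?_
    gcongr
    rwa [ENNReal.le_div_iff_mul_le (.inl hF0) (.inl hFt)]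
  have lim (c : ℝ) : Tendsto (fun R : ℝ => volume (ball (0 : EuclideanSpace ℝ (Fin 2)) (R + c)) *
      (volume A / volume F) / ENNReal.ofReal (π * R ^ 2)) atTop
      (nhds (volume A / volume F)) := by
    have := ENNReal.Tendsto.mul_const (b := volume A / volume F)
      (tendsto_volume_ball_add_div c) (.inl one_ne_zero)
    simpa only [one_mul, ENNReal.mul_div_right_comm] using this
  exact tendsto_of_tendsto_of_tendsto_of_le_of_le (lim _) (lim _)
    (fun R => ENNReal.div_le_div_right (lower R) _) (fun R => ENNReal.div_le_div_right (upper R) _)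

theorem volume_fundamentalDomain_euclidean {ι : Type*} [Fintype ι] [DecidableEq ι]
    (b : Module.Basis ι ℝ (EuclideanSpace ℝ ι)) :
    volume (ZSpan.fundamentalDomain b) =
      ENNReal.ofReal |(Matrix.of fun i j => b j i).det| := by
  have h := (EuclideanSpace.basisFun ι ℝ).volume_parallelepiped
  rw [ZSpan.measure_fundamentalDomain b volume (EuclideanSpace.basisFun ι ℝ).toBasis,
    measure_congr (ZSpan.fundamentalDomain_ae_parallelepiped _ volume)]
  simp only [OrthonormalBasis.coe_toBasis, h, mul_one]
  rfl

theorem hexagonal_packing_density :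
    let v₁ : EuclideanSpace ℝ (Fin 2) := (EuclideanSpace.equiv (Fin 2) ℝ).symm ![2, 0]
    let v₂ : EuclideanSpace ℝ (Fin 2) := (EuclideanSpace.equiv (Fin 2) ℝ).symm ![1, Real.sqrt 3]
    let S : Set (EuclideanSpace ℝ (Fin 2)) :=
      {x | ∃ m n : ℤ, x = m • v₁ + n • v₂}
    (∀ p ∈ S, ∀ q ∈ S, p ≠ q → 2 ≤ dist p q) ∧
    Tendsto (fun R : ℝ =>
        volume ((⋃ p ∈ S, ball p 1) ∩ ball (0 : EuclideanSpace ℝ (Fin 2)) R) /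
          ENNReal.ofReal (π * R ^ 2)) atTop
      (nhds (ENNReal.ofReal (π / Real.sqrt 12))) := by
  intro v₁ v₂ S
  have hsep : ∀ p ∈ S, ∀ q ∈ S, p ≠ q → 2 ≤ dist p q := by
    rintro _ ⟨m, n, rfl⟩ _ ⟨k, l, rfl⟩ hne
    have hsub : m • v₁ + n • v₂ - (k • v₁ + l • v₂) = (m - k) • v₁ + (n - l) • v₂ := by
      rw [sub_smul, sub_smul]; abel
    have hq : 1 ≤ (m - k) ^ 2 + (m - k) * (n - l) + (n - l) ^ 2 := by
      by_contra! h
      have hn : n - l = 0 := by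
        by_contra hn
        nlinarith [sq_nonneg (2 * (m - k) + (n - l)), sq_pos_of_ne_zero hn]
      have hm : m - k = 0 := by
        by_contra hm
        nlinarith [sq_pos_of_ne_zero hm]
      rw [sub_eq_zero.1 hm, sub_eq_zero.1 hn] at hne
      exact hne rfl
    have h := norm_sq_hexagonal_lattice (m - k) (n - l)
    have hq' := (Int.cast_le (R := ℝ)).2 hq
    rw [dist_eq_norm, hsub]
    refine (sq_le_sq₀ (by norm_num) (norm_nonneg _)).1 ?_
    refine le_trans ?_ h.ge
    push_cast at hq' ⊢
    linarith
  refine ⟨hsep, ?_⟩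
  have h3 : (0 : ℝ) < √3 := by positivity
  have hli : LinearIndependent ℝ ![v₁, v₂] := by
    refine LinearIndependent.pair_iff.2 fun s t h => ?_
    have h0 := congrArg (fun x : EuclideanSpace ℝ (Fin 2) => x 0) h
    have h1 := congrArg (fun x : EuclideanSpace ℝ (Fin 2) => x 1) h
    simp [v₁, v₂] at h0 h1
    simp_all
  let b := basisOfLinearIndependentOfCardEqFinrank hli (by simp)
  have hb : ⇑b = ![v₁, v₂] := coe_basisOfLinearIndependentOfCardEqFinrank _ _
  have hbS : (Submodule.span ℤ (Set.range b) : Set (EuclideanSpace ℝ (Fin 2))) = S := by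
    ext x
    rw [hb, Matrix.range_cons_cons_empty, SetLike.mem_coe, Submodule.mem_span_pair]
    simp only [S, Set.mem_ofPred_eq, eq_comm]
  have hball (p : EuclideanSpace ℝ (Fin 2)) :
      p +ᵥ ball (0 : EuclideanSpace ℝ (Fin 2)) 1 = ball p 1 := by
    rw [vadd_ball, vadd_eq_add, add_zero]
  have key := tendsto_density_lattice_translates b (A := ball 0 1) measurableSet_ball (D := 1)
    (fun x hx => (mem_ball_zero_iff.1 hx).le) (by
      rw [hbS]
      intro p hp q hq hpq
      simp only [Function.onFun, hball]
      exact ball_disjoint_ball (by linarith [hsep p hp q hq hpq]))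
  have hvol : volume (ball (0 : EuclideanSpace ℝ (Fin 2)) 1) / volume (ZSpan.fundamentalDomain b) =
      ENNReal.ofReal (π / √12) := by
    have h12 : √12 = 2 * √3 := by
      rw [show (12 : ℝ) = 2 ^ 2 * 3 by norm_num, Real.sqrt_mul (by norm_num),
        Real.sqrt_sq (by norm_num)]
    rw [volume_fundamentalDomain_euclidean, EuclideanSpace.volume_ball_fin_two, hb,
      Matrix.det_fin_two, ENNReal.ofReal_div_of_pos (by positivity), h12]
    simp [v₁, v₂, abs_of_pos h3]
  rw [hvol, hbS] at key
  simpa only [hball] using key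
end
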